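/- (Marshall) Let f ∈ ℝ[X,Y] with f ≥ 0 on the strip [0,1]×ℝ. Then there exist sums of squares σ₀, σ₁ in ℝ[X,Y] such that f = σ₀ + σ₁·X(1−X). -/

import Mathlib

namespace StripPositivity

open Polynomial
open scoped Polynomial.Bivariate

section Continuity

lemma nonneg_of_finite_exception {U F : Set ℝ} (hU : IsOpen U) (hF : F.Finite) {g : ℝ → ℝ}
    (hg : Continuous g) (h : ∀ x ∈ U, x ∉ F → 0 ≤ g x) : ∀ x ∈ closure U, 0 ≤ g x := by
  have hd : Dense Fᶜ := hF.countable.dense_compl ℝ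
  have h1 : closure U ⊆ closure (U ∩ Fᶜ) :=
    closure_minimal (hd.open_subset_closure_inter hU) isClosed_closure
  have h2 : closure (U ∩ Fᶜ) ⊆ {x | 0 ≤ g x} :=
    closure_minimal (fun x hx => h x hx.1 hx.2) (isClosed_le continuous_const hg)
  exact fun x hx => h2 (h1 hx)

lemma eq_zero_of_sub_mul_nonneg {U : Set ℝ} (hU : IsOpen U) {a : ℝ} (ha : a ∈ U) {g : ℝ → ℝ}
    (hg : Continuous g) (h : ∀ x ∈ U, 0 ≤ (x - a) * g x) : g a = 0 := by
  apply le_antisymm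
  · refine le_of_tendsto (hg.continuousAt.mono_left (nhdsWithin_le_nhds (s := Set.Iio a))) ?_
    filter_upwards [nhdsWithin_le_nhds (hU.mem_nhds ha), self_mem_nhdsWithin] with x hx hxa
    have := h x hx
    have hxa : x < a := hxa
    nlinarith
  · refine ge_of_tendsto (hg.continuousAt.mono_left (nhdsWithin_le_nhds (s := Set.Ioi a))) ?_
    filter_upwards [nhdsWithin_le_nhds (hU.mem_nhds ha), self_mem_nhdsWithin] with x hx hxa
    have := h x hx
    have hxa : a < x := hxa
    by_contra hc
    nlinarith

end Continuity

section Univariate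

/-- A polynomial that keeps its sign near a root has a double root there. -/
lemma exists_eq_sq_mul_of_root {U : Set ℝ} (hU : IsOpen U) {a : ℝ} (ha : a ∈ U) {p : ℝ[X]}
    (hp : ∀ x ∈ U, 0 ≤ p.eval x) (hr : p.IsRoot a) : ∃ q : ℝ[X], p = (X - C a) ^ 2 * q := by
  obtain ⟨q, rfl⟩ := dvd_iff_isRoot.mpr hr
  have h0 : q.eval a = 0 := by
    refine eq_zero_of_sub_mul_nonneg hU ha q.continuous (fun x hx => ?_)
    simpa using hp x hx
  obtain ⟨q', rfl⟩ := dvd_iff_isRoot.mpr h0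
  exact ⟨q', by ring⟩

lemma natDegree_lt_of_eq_mul {p m q : ℝ[X]} (hp : p ≠ 0) (h : p = m * q) (hm : 0 < m.natDegree) :
    q.natDegree < p.natDegree := by
  subst h
  rw [natDegree_mul (left_ne_zero_of_mul hp) (right_ne_zero_of_mul hp)]
  omega

lemma exists_root_or_quadratic {p : ℝ[X]} (hp : 0 < p.natDegree) :
    (∃ a, p.IsRoot a) ∨
      ∃ a b : ℝ, b ≠ 0 ∧ ((X - C a) ^ 2 + C b ^ 2) ∣ p := by
  obtain ⟨z, hz⟩ := IsAlgClosed.exists_aeval_eq_zero ℂ p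
    (by rw [degree_eq_natDegree (by rintro rfl; simp at hp)]; exact_mod_cast hp.ne')
  by_cases him : z.im = 0
  · left
    refine ⟨z.re, ?_⟩
    have : z = (z.re : ℂ) := Complex.ext rfl (by simpa using him)
    rw [this] at hz
    have h2 : aeval ((algebraMap ℝ ℂ) z.re) p = 0 := hz
    rw [aeval_algebraMap_apply] at h2
    simpa using h2
  · right
    refine ⟨z.re, z.im, him, ?_⟩
    have := Polynomial.quadratic_dvd_of_aeval_eq_zero_im_ne_zero p hz him
    convert this using 1
    rw [← Complex.normSq_eq_norm_sq, Complex.normSq_apply]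
    simp only [map_mul, map_add, C_ofNat]
    ring

lemma quadratic_eval_pos {a b : ℝ} (hb : b ≠ 0) (x : ℝ) :
    0 < (((X - C a) ^ 2 + C b ^ 2 : ℝ[X])).eval x := by
  simp only [eval_add, eval_pow, eval_sub, eval_X, eval_C]
  positivity

lemma quadratic_natDegree (a b : ℝ) : ((X - C a) ^ 2 + C b ^ 2 : ℝ[X]).natDegree = 2 := by
  rw [← C_pow, natDegree_add_C, natDegree_pow, natDegree_X_sub_C]

/-- Sums of squares of polynomials of degree at most `d`. -/
noncomputable def boundedSumSq (d : ℕ) : AddSubmonoid ℝ[X] :=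
  AddSubmonoid.closure {f | ∃ g : ℝ[X], g.natDegree ≤ d ∧ f = g ^ 2}

lemma sq_mul_mem_boundedSumSq {d e : ℕ} {p m : ℝ[X]} (hm : m.natDegree ≤ e)
    (hp : p ∈ boundedSumSq d) : m ^ 2 * p ∈ boundedSumSq (e + d) := by
  induction hp using AddSubmonoid.closure_induction with
  | mem x hx =>
    obtain ⟨g, hg, rfl⟩ := hx
    exact AddSubmonoid.subset_closure
      ⟨m * g, natDegree_mul_le_of_le hm hg, by ring⟩
  | zero => simp
  | add x y _ _ hx hy => rw [mul_add]; exact add_mem hx hy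

lemma boundedSumSq_mono {d e : ℕ} (h : d ≤ e) : boundedSumSq d ≤ boundedSumSq e :=
  AddSubmonoid.closure_mono (fun _ ⟨g, hg, hf⟩ => ⟨g, hg.trans h, hf⟩)

lemma mem_boundedSumSq_of_nonneg (p : ℝ[X]) (hp : ∀ x, 0 ≤ p.eval x) :
    p ∈ boundedSumSq (p.natDegree / 2) := by
  induction hn : p.natDegree using Nat.strong_induction_on generalizing p with
  | _ n ih =>
  subst hn
  by_cases h0 : p.natDegree = 0
  · obtain ⟨c, rfl⟩ := natDegree_eq_zero.mp h0
    have hc : 0 ≤ c := by simpa using hp 0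
    exact AddSubmonoid.subset_closure
      ⟨C √c, by simp, by rw [← C_pow, Real.sq_sqrt hc]⟩
  have hp0 : p ≠ 0 := by rintro rfl; simp at h0
  rcases exists_root_or_quadratic (Nat.pos_of_ne_zero h0) with ⟨a, ha⟩ | ⟨a, b, hb, q, hq⟩
  · obtain ⟨q, hq⟩ := exists_eq_sq_mul_of_root isOpen_univ (Set.mem_univ a) (fun x _ => hp x) ha
    have hq' : ∀ x, 0 ≤ q.eval x := by
      have := nonneg_of_finite_exception isOpen_univ (Set.finite_singleton a) q.continuous
        (fun x _ hx => ?_)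
      · simpa using this
      · have h1 := hp x
        rw [hq] at h1
        simp only [eval_mul, eval_pow, eval_sub, eval_X, eval_C] at h1
        have h2 : 0 < (x - a) ^ 2 := by
          have : x - a ≠ 0 := sub_ne_zero.mpr hx
          positivity
        exact nonneg_of_mul_nonneg_right h1 h2
    have hd : p.natDegree = 2 + q.natDegree := by
      have hq0 : q ≠ 0 := by rintro rfl; simp [hq] at hp0
      rw [hq, natDegree_mul (pow_ne_zero _ (X_sub_C_ne_zero a)) hq0, natDegree_pow,
        natDegree_X_sub_C]
    have := sq_mul_mem_boundedSumSq (m := X - C a) (e := 1) (by simp) (ih _ (by omega) q hq' rfl)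
    rw [← hq] at this
    convert this using 2
    omega
  · have hq' : ∀ x, 0 ≤ q.eval x := fun x => by
      have h1 := hp x
      rw [hq, eval_mul] at h1
      exact nonneg_of_mul_nonneg_right h1 (quadratic_eval_pos hb x)
    have hd : p.natDegree = 2 + q.natDegree := by
      have hq0 : q ≠ 0 := by rintro rfl; simp [hq] at hp0
      have hm0 : ((X - C a) ^ 2 + C b ^ 2 : ℝ[X]) ≠ 0 := by
        intro h; simp [h] at hq; exact hp0 hq
      rw [hq, natDegree_mul hm0 hq0, quadratic_natDegree]
    have hi := ih _ (by omega) q hq' rfl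
    have h1 := sq_mul_mem_boundedSumSq (m := X - C a) (e := 1) (by simp) hi
    have h2 := sq_mul_mem_boundedSumSq (m := C b) (e := 1) (by simp) hi
    have h3 := add_mem h1 h2
    rw [← add_mul, ← hq] at h3
    convert h3 using 2
    omega

/-- The quadratic module generated by `X (1 - X)`. -/
def IntervalCert (p : ℝ[X]) : Prop :=
  ∃ σ₀ σ₁ : ℝ[X], IsSumSq σ₀ ∧ IsSumSq σ₁ ∧ p = σ₀ + σ₁ * (X * (1 - X))

lemma IntervalCert.mul {p q : ℝ[X]} (hp : IntervalCert p) (hq : IntervalCert q) :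
    IntervalCert (p * q) := by
  obtain ⟨a, b, ha, hb, rfl⟩ := hp
  obtain ⟨c, d, hc, hd, rfl⟩ := hq
  refine ⟨a * c + b * d * ((X * (1 - X)) * (X * (1 - X))), a * d + b * c,
    (ha.mul hc).add ((hb.mul hd).mul (IsSumSq.mul_self _)), (ha.mul hd).add (hb.mul hc), by ring⟩

lemma IntervalCert.of_isSumSq {p : ℝ[X]} (hp : IsSumSq p) : IntervalCert p :=
  ⟨p, 0, hp, .zero, by simp⟩

lemma IntervalCert.add {p q : ℝ[X]} (hp : IntervalCert p) (hq : IntervalCert q) :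
    IntervalCert (p + q) := by
  obtain ⟨a, b, ha, hb, rfl⟩ := hp
  obtain ⟨c, d, hc, hd, rfl⟩ := hq
  exact ⟨a + c, b + d, ha.add hc, hb.add hd, by ring⟩

lemma isSumSq_sq {R : Type*} [CommSemiring R] (a : R) : IsSumSq (a ^ 2) := by
  rw [pow_two]; exact IsSumSq.mul_self _

lemma IntervalCert.const {c : ℝ} (hc : 0 ≤ c) : IntervalCert (C c) :=
  .of_isSumSq (by simpa [← C_pow, Real.sq_sqrt hc] using isSumSq_sq (C √c))

lemma IntervalCert.X : IntervalCert (X : ℝ[X]) :=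
  ⟨Polynomial.X ^ 2, 1, isSumSq_sq _, by simp, by ring⟩

lemma IntervalCert.one_sub_X : IntervalCert (1 - Polynomial.X : ℝ[X]) :=
  ⟨(1 - Polynomial.X) ^ 2, 1, isSumSq_sq _, by simp, by ring⟩

lemma closure_Ioo_zero_one : closure (Set.Ioo (0 : ℝ) 1) = Set.Icc 0 1 :=
  closure_Ioo zero_ne_one

lemma intervalCert_of_nonneg (p : ℝ[X]) (hp : ∀ x ∈ Set.Icc (0 : ℝ) 1, 0 ≤ p.eval x) :
    IntervalCert p := by
  induction hn : p.natDegree using Nat.strong_induction_on generalizing p with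
  | _ n ih =>
  subst hn
  by_cases h0 : p.natDegree = 0
  · obtain ⟨c, rfl⟩ := natDegree_eq_zero.mp h0
    exact .const (by simpa using hp 0)
  have hp0 : p ≠ 0 := by rintro rfl; simp at h0
  have key : ∀ (m q : ℝ[X]) (a : ℝ), p = m * q → 0 < m.natDegree → IntervalCert m →
      (∀ x ∈ Set.Ioo (0 : ℝ) 1, x ≠ a → 0 < m.eval x) → IntervalCert p := by
    intro m q a h hm hc hpos
    rw [h]
    refine hc.mul (ih _ (natDegree_lt_of_eq_mul hp0 h hm) q ?_ rfl)
    rw [← closure_Ioo_zero_one]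
    refine nonneg_of_finite_exception isOpen_Ioo (Set.finite_singleton a) q.continuous
      (fun x hx hxa => ?_)
    have h1 := hp x (Set.Ioo_subset_Icc_self hx)
    rw [h, eval_mul] at h1
    exact nonneg_of_mul_nonneg_right h1 (hpos x hx hxa)
  rcases exists_root_or_quadratic (Nat.pos_of_ne_zero h0) with ⟨a, ha⟩ | ⟨a, b, hb, q, hq⟩
  · by_cases h1 : a ≤ 0
    · obtain ⟨q, hq⟩ := dvd_iff_isRoot.mpr ha
      refine key _ q a hq (by simp) ?_ (fun x hx _ => ?_)
      · have := IntervalCert.X.add (.const (neg_nonneg.mpr h1))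
        simpa [sub_eq_add_neg] using this
      · simp; linarith [hx.1]
    by_cases h2 : 1 ≤ a
    · obtain ⟨q, hq⟩ := dvd_iff_isRoot.mpr ha
      refine key (C a - X) (-q) a (by rw [hq]; ring) ?_ ?_ (fun x hx _ => ?_)
      · rw [← neg_sub, natDegree_neg]; simp
      · have := IntervalCert.one_sub_X.add (.const (sub_nonneg.mpr h2))
        have h3 : (1 - X + C (a - 1) : ℝ[X]) = C a - X := by simp
        rwa [h3] at this
      · simp; linarith [hx.2]
    · push Not at h1 h2
      obtain ⟨q, hq⟩ := exists_eq_sq_mul_of_root isOpen_Ioo (U := Set.Ioo 0 1) ⟨h1, h2⟩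
        (fun x hx => hp x (Set.Ioo_subset_Icc_self hx)) ha
      refine key _ q a hq (by simp [natDegree_pow]) (.of_isSumSq (isSumSq_sq _))
        (fun x hx hxa => ?_)
      simp only [eval_pow, eval_sub, eval_X, eval_C]
      have : x - a ≠ 0 := sub_ne_zero.mpr hxa
      positivity
  · refine key _ q 0 hq (by rw [quadratic_natDegree]; norm_num)
      (.of_isSumSq ((isSumSq_sq _).add (isSumSq_sq _))) (fun x _ _ => quadratic_eval_pos hb x)

end Univariate

section Puiseux

lemma exists_monic_dvd_of_constantCoeff {K : Type*} [Field K] {p : (PowerSeries K)[X]} {m : ℕ}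
    (h0 : ∀ i < m, PowerSeries.constantCoeff (p.coeff i) = 0)
    (hm : PowerSeries.constantCoeff (p.coeff m) ≠ 0) :
    ∃ P : (PowerSeries K)[X], P.Monic ∧ P ∣ p ∧ P.natDegree = m := by
  have : IsAdicComplete (IsLocalRing.maximalIdeal (PowerSeries K)) (PowerSeries K) :=
    (PowerSeries.maximalIdeal_eq_span_X (k := K)) ▸ inferInstance
  have hmem (a : PowerSeries K) : IsLocalRing.residue (PowerSeries K) a = 0 ↔
      PowerSeries.constantCoeff a = 0 := by
    rw [IsLocalRing.residue_eq_zero_iff, PowerSeries.maximalIdeal_eq_span_X,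
      Ideal.mem_span_singleton, PowerSeries.X_dvd_iff]
  set g : PowerSeries (PowerSeries K) := (p : PowerSeries (PowerSeries K)) with hg
  have hord : (g.map (IsLocalRing.residue (PowerSeries K))).order = m := by
    rw [PowerSeries.order_eq_nat]
    simp only [PowerSeries.coeff_map, hg, Polynomial.coeff_coe]
    exact ⟨fun h => hm ((hmem _).1 h), fun i hi => (hmem _).2 (h0 i hi)⟩
  have hne : g.map (IsLocalRing.residue (PowerSeries K)) ≠ 0 := by
    intro h
    rw [h, PowerSeries.order_zero] at hord
    exact ENat.top_ne_natCast m hord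
  obtain ⟨P, h, H⟩ := PowerSeries.exists_isWeierstrassFactorization hne
  have hP := H.isDistinguishedAt.monic
  have hdeg : P.natDegree = m := by
    rw [H.natDegree_eq_toNat_order_map, hord, ENat.toNat_natCast]
  refine ⟨P, hP, ?_, hdeg⟩
  have hW := H.isDistinguishedAt.isWeierstrassDivisorAt'
  have hordP := H.isDistinguishedAt.coe_natDegree_eq_order_map (P : PowerSeries (PowerSeries K)) 1
    (by rw [map_one, ← Ideal.ne_top_iff_one]; exact Ideal.IsMaximal.ne_top inferInstance) (by simp)
  have key := hW.eq_zero_of_mul_eq (q := h - (p /ₘ P : (PowerSeries K)[X])) (r := p %ₘ P)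
    (by
      rw [← hordP, ENat.toNat_natCast, ← degree_eq_natDegree hP.ne_zero]
      exact degree_modByMonic_lt p hP)
    (by
      have h1 := congrArg (fun q : (PowerSeries K)[X] => (q : PowerSeries (PowerSeries K)))
        (modByMonic_add_div p P)
      simp only [Polynomial.coe_add, Polynomial.coe_mul] at h1
      rw [mul_sub, ← H.eq_mul, hg, ← h1]
      ring)
  exact (modByMonic_eq_zero_iff_dvd hP).1 key.2

/-- The substitution `X ↦ X ^ e` on power series. -/
noncomputable def ramify (R : Type*) [CommRing R] (e : ℕ) (he : e ≠ 0) :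
    PowerSeries R →+* PowerSeries R :=
  (PowerSeries.expand e he).toRingHom

lemma ramify_apply {R : Type*} [CommRing R] {e : ℕ} (he : e ≠ 0) (a : PowerSeries R) :
    ramify R e he a = PowerSeries.expand e he a := rfl

lemma ramify_comp {R : Type*} [CommRing R] {e e' : ℕ} (he : e ≠ 0) (he' : e' ≠ 0) :
    (ramify R e he).comp (ramify R e' he') = ramify R (e * e') (mul_ne_zero he he') :=
  RingHom.ext fun a => (PowerSeries.expand_mul e he e' he' a).symm

lemma ramify_injective {R : Type*} [CommRing R] {e : ℕ} (he : e ≠ 0) :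
    Function.Injective (ramify R e he) := by
  intro a b h
  ext n
  have := congrArg (PowerSeries.coeff (e * n)) h
  simpa [ramify_apply] using this

/-- `p` has a root among the Puiseux series. -/
def HasPuiseuxRoot (p : (PowerSeries ℂ)[X]) : Prop :=
  ∃ (e : ℕ) (he : e ≠ 0) (α : PowerSeries ℂ), p.eval₂ (ramify ℂ e he) α = 0

lemma HasPuiseuxRoot.of_dvd {p q : (PowerSeries ℂ)[X]} (h : HasPuiseuxRoot q) (hd : q ∣ p) :
    HasPuiseuxRoot p := by
  obtain ⟨e, he, α, hα⟩ := h
  exact ⟨e, he, α, eval₂_eq_zero_of_dvd_of_eval₂_eq_zero _ _ hd hα⟩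

lemma HasPuiseuxRoot.of_taylor {p : (PowerSeries ℂ)[X]} {r : PowerSeries ℂ}
    (h : HasPuiseuxRoot (taylor r p)) : HasPuiseuxRoot p := by
  obtain ⟨e, he, α, hα⟩ := h
  refine ⟨e, he, α + ramify ℂ e he r, ?_⟩
  rw [taylor_apply, eval₂_comp] at hα
  simpa using hα

lemma HasPuiseuxRoot.of_ramify {p : (PowerSeries ℂ)[X]} {e : ℕ} (he : e ≠ 0)
    (h : HasPuiseuxRoot (p.map (ramify ℂ e he))) : HasPuiseuxRoot p := by
  obtain ⟨e', he', α, hα⟩ := h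
  refine ⟨e' * e, mul_ne_zero he' he, α, ?_⟩
  rwa [eval₂_map, ramify_comp] at hα

lemma HasPuiseuxRoot.scaleRoots {p : (PowerSeries ℂ)[X]} (h : HasPuiseuxRoot p)
    (s : PowerSeries ℂ) : HasPuiseuxRoot (p.scaleRoots s) := by
  obtain ⟨e, he, α, hα⟩ := h
  exact ⟨e, he, _, scaleRoots_eval₂_eq_zero _ hα⟩

lemma exists_taylor_nextCoeff_eq_zero {p : (PowerSeries ℂ)[X]} (hp : p.Monic) {n : ℕ}
    (hn : p.natDegree = n + 1) : ∃ r, (taylor r p).coeff n = 0 := by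
  refine ⟨PowerSeries.C (-((n + 1 : ℕ) : ℂ)⁻¹) * p.coeff n, ?_⟩
  set r := PowerSeries.C (-((n + 1 : ℕ) : ℂ)⁻¹) * p.coeff n
  rw [taylor_coeff]
  have hd : (hasseDeriv n p).natDegree ≤ 1 := by
    have := natDegree_hasseDeriv_le p n
    omega
  rw [eq_X_add_C_of_natDegree_le_one hd]
  have h1 : p.coeff (1 + n) = 1 := by rw [add_comm, ← hn]; exact hp
  simp only [hasseDeriv_coeff, h1, eval_add, eval_mul, eval_C, eval_X]
  have h3 : (1 + n).choose n = 1 + n := by rw [add_comm, Nat.choose_succ_self_right]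
  rw [h3]
  simp only [zero_add, Nat.choose_self, Nat.cast_one, one_mul, mul_one]
  have h2 : ((1 + n : ℕ) : PowerSeries ℂ) = PowerSeries.C ((n + 1 : ℕ) : ℂ) := by
    rw [map_natCast, add_comm]
  rw [h2, ← mul_assoc, ← map_mul]
  have : ((n + 1 : ℕ) : ℂ) * (-((n + 1 : ℕ) : ℂ)⁻¹) = -1 := by
    push_cast; field_simp
  rw [this]; simp

lemma X_pow_dvd_iff_le_order {φ : PowerSeries ℂ} {n : ℕ} :
    (PowerSeries.X : PowerSeries ℂ) ^ n ∣ φ ↔ (n : ℕ∞) ≤ φ.order := by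
  rw [PowerSeries.order_eq_emultiplicity_X, ← pow_dvd_iff_le_emultiplicity]

lemma exists_ramify_eq_scaleRoots {p : (PowerSeries ℂ)[X]} (hp : p.Monic) {n : ℕ}
    (hn : p.natDegree = n) (hne : p ≠ X ^ n) :
    ∃ (e : ℕ) (he : e ≠ 0) (a : ℕ) (q : (PowerSeries ℂ)[X]), q.Monic ∧ q.natDegree = n ∧
      p.map (ramify ℂ e he) = q.scaleRoots (PowerSeries.X ^ a) ∧
      (∀ i, p.coeff i = 0 → q.coeff i = 0) ∧
      ∃ i < n, PowerSeries.constantCoeff (q.coeff i) ≠ 0 := by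
  classical
  set e := n.factorial with he_def
  have he : e ≠ 0 := n.factorial_ne_zero
  have hdvd : ∀ i < n, (n - i) * (e / (n - i)) = e := fun i hi =>
    Nat.mul_div_cancel' (Nat.dvd_factorial (by omega) (Nat.sub_le _ _))
  set w : ℕ → ℕ := fun i => (p.coeff i).order.toNat * (e / (n - i)) with hw
  have hS : ((Finset.range n).filter fun i => p.coeff i ≠ 0).Nonempty := by
    rw [Finset.nonempty_iff_ne_empty]
    intro h
    apply hne
    rw [Finset.filter_eq_empty_iff] at h
    ext1 i
    rw [coeff_X_pow]
    rcases lt_trichotomy i n with hi | rfl | hi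
    · rw [if_neg hi.ne]
      simpa using h (Finset.mem_range.2 hi)
    · rw [if_pos rfl, ← hn]; exact hp
    · rw [if_neg hi.ne', coeff_eq_zero_of_natDegree_lt (hn ▸ hi)]
  obtain ⟨i₀, hi₀, hmin⟩ := Finset.exists_min_image _ w hS
  simp only [Finset.mem_filter, Finset.mem_range] at hi₀ hmin
  have hord : ∀ i < n, p.coeff i ≠ 0 →
      (ramify ℂ e he (p.coeff i)).order = ((n - i) * w i : ℕ) := by
    intro i hi h0
    rw [ramify_apply, PowerSeries.order_expand,
      ← ENat.natCast_toNat (PowerSeries.order_eq_top.not.2 h0)]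
    rw [hw]
    dsimp only
    conv_rhs => rw [mul_left_comm, hdvd i hi]
    push_cast
    rw [nsmul_eq_mul, mul_comm]
  have hb : ∀ i < n, ∃ b, ramify ℂ e he (p.coeff i) = b * (PowerSeries.X ^ w i₀) ^ (n - i) := by
    intro i hi
    by_cases h0 : p.coeff i = 0
    · exact ⟨0, by simp [h0]⟩
    · obtain ⟨b, hb⟩ := (X_pow_dvd_iff_le_order (n := (n - i) * w i₀)
        (φ := ramify ℂ e he (p.coeff i))).2 (by
          rw [hord i hi h0]
          exact_mod_cast Nat.mul_le_mul_left _ (hmin i ⟨hi, h0⟩))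
      exact ⟨b, by rw [hb, ← pow_mul, mul_comm (w i₀), mul_comm]⟩
  choose! b hb using hb
  have hb0 : ∀ i < n, p.coeff i = 0 → b i = 0 := by
    intro i hi h0
    have := hb i hi
    rw [h0, map_zero] at this
    rcases mul_eq_zero.1 this.symm with h | h
    · exact h
    · exact absurd h (pow_ne_zero _ (pow_ne_zero _ PowerSeries.X_ne_zero))
  set r : (PowerSeries ℂ)[X] := ∑ i ∈ Finset.range n, C (b i) * X ^ i with hr
  have hrc : ∀ i, r.coeff i = if i < n then b i else 0 := by
    intro i
    simp [hr, finsetSum_coeff, coeff_X_pow]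
  have hrd : r.degree < n := by
    rw [degree_lt_iff_coeff_zero]
    intro m hm
    rw [hrc, if_neg (by omega)]
  have hqd : (X ^ n + r).natDegree = n := natDegree_eq_of_degree_eq_some (by
    rw [degree_add_eq_left_of_degree_lt (by rwa [degree_X_pow]), degree_X_pow])
  have hqm : (X ^ n + r).Monic := monic_X_pow_add hrd
  refine ⟨e, he, w i₀, X ^ n + r, hqm, hqd, ?_, ?_, i₀, hi₀.1, ?_⟩
  · ext1 i
    rw [coeff_map, coeff_scaleRoots, hqd, coeff_add, hrc, coeff_X_pow]
    rcases lt_trichotomy i n with hi | rfl | hi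
    · rw [if_neg hi.ne, if_pos hi, zero_add, hb i hi]
    · have : p.coeff i = 1 := by rw [← hn]; exact hp
      simp [this]
    · rw [if_neg hi.ne', if_neg (by omega), coeff_eq_zero_of_natDegree_lt (hn ▸ hi)]
      simp
  · intro i hi
    rw [coeff_add, hrc, coeff_X_pow]
    rcases lt_trichotomy i n with h | rfl | h
    · rw [if_neg h.ne, if_pos h, hb0 i h hi, add_zero]
    · have : p.coeff i = 1 := by rw [← hn]; exact hp
      exact absurd (this.symm.trans hi) one_ne_zero
    · rw [if_neg h.ne', if_neg (by omega), add_zero]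
  · rw [coeff_add, hrc, coeff_X_pow, if_neg hi₀.1.ne, if_pos hi₀.1, zero_add]
    intro hc
    obtain ⟨c, hc⟩ := PowerSeries.X_dvd_iff.2 hc
    have h1 : (PowerSeries.X : PowerSeries ℂ) ^ ((n - i₀) * w i₀ + 1) ∣
        ramify ℂ e he (p.coeff i₀) := ⟨c, by
      rw [hb i₀ hi₀.1, hc, ← pow_mul, pow_succ, mul_comm (w i₀)]; ring⟩
    have h2 := X_pow_dvd_iff_le_order.1 h1
    rw [hord i₀ hi₀.1 hi₀.2] at h2
    have h3 : (n - i₀) * w i₀ + 1 ≤ (n - i₀) * w i₀ := by exact_mod_cast h2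
    omega

theorem hasPuiseuxRoot_of_monic (p : (PowerSeries ℂ)[X]) (hp : p.Monic) (h0 : p.natDegree ≠ 0) :
    HasPuiseuxRoot p := by
  induction hN : p.natDegree using Nat.strong_induction_on generalizing p with
  | _ N ih =>
  obtain ⟨n, rfl⟩ : ∃ n, N = n + 1 := Nat.exists_eq_succ_of_ne_zero (hN ▸ h0)
  obtain ⟨r, hr⟩ := exists_taylor_nextCoeff_eq_zero hp hN
  apply HasPuiseuxRoot.of_taylor (r := r)
  have hp1 : (taylor r p).Monic := by rw [Monic, leadingCoeff_taylor, hp]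
  have hd1 : (taylor r p).natDegree = n + 1 := by rw [natDegree_taylor, hN]
  generalize taylor r p = p₁ at hr hp1 hd1
  by_cases hX : p₁ = X ^ (n + 1)
  · exact ⟨1, one_ne_zero, 0, by simp [hX]⟩
  obtain ⟨e, he, a, q, hq, hqd, hscale, hz, i₀, hi₀, hne⟩ :=
    exists_ramify_eq_scaleRoots hp1 hd1 hX
  apply HasPuiseuxRoot.of_ramify he
  rw [hscale]
  apply HasPuiseuxRoot.scaleRoots
  set g := q.map (PowerSeries.constantCoeff (R := ℂ)) with hg
  have hgm : g.Monic := hq.map _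
  have hgd : g.natDegree = n + 1 := by rw [hg, hq.natDegree_map, hqd]
  obtain ⟨c, hc⟩ := IsAlgClosed.exists_root g (by
    rw [degree_eq_natDegree hgm.ne_zero, hgd]; exact_mod_cast n.succ_ne_zero)
  set h := taylor c g with hh
  have hhm : h.Monic := by rw [hh, Monic, leadingCoeff_taylor, hgm]
  have hhd : h.natDegree = n + 1 := by rw [hh, natDegree_taylor, hgd]
  have hmap : (taylor (PowerSeries.C c) q).map PowerSeries.constantCoeff = h := by
    rw [hh, hg, map_taylor]; simp
  have hex : ∃ m, h.coeff m ≠ 0 := ⟨n + 1, by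
    have : h.coeff (n + 1) = 1 := by rw [← hhd]; exact hhm
    rw [this]; exact one_ne_zero⟩
  have hm0 : Nat.find hex ≠ 0 := by
    intro hm
    have := Nat.find_spec hex
    rw [hm, hh, taylor_coeff_zero] at this
    exact this hc
  have hmn : Nat.find hex < n + 1 := by
    by_contra hlt
    rw [not_lt] at hlt
    have hhX : h = X ^ (n + 1) := by
      ext1 i
      rw [coeff_X_pow]
      rcases lt_trichotomy i (n + 1) with hi | rfl | hi
      · rw [if_neg hi.ne]
        simpa using Nat.find_min hex (lt_of_lt_of_le hi hlt)
      · rw [if_pos rfl, ← hhd]; exact hhm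
      · rw [if_neg hi.ne', coeff_eq_zero_of_natDegree_lt (hhd ▸ hi)]
    have hgX : g = (X - C c) ^ (n + 1) := by
      have h1 : taylor (-c) h = g := by rw [hh, taylor_taylor]; simp
      rw [← h1, hhX]
      simp [taylor_apply, sub_eq_add_neg]
    have hcoef : g.coeff n = 0 := by rw [hg, coeff_map, hz n hr, map_zero]
    have hc0 : c = 0 := by
      rw [hgX, sub_eq_add_neg, ← C_neg, coeff_X_add_C_pow] at hcoef
      have h1 : n + 1 - n = 1 := by omega
      rw [h1, Nat.choose_succ_self_right, pow_one] at hcoef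
      rcases mul_eq_zero.1 hcoef with h | h
      · simpa using h
      · exact absurd h (by exact_mod_cast n.succ_ne_zero)
    apply hne
    have : g.coeff i₀ = 0 := by
      rw [hgX, hc0, C_0, sub_zero, coeff_X_pow, if_neg hi₀.ne]
    rwa [hg, coeff_map] at this
  obtain ⟨P, hP, hPd, hPn⟩ := exists_monic_dvd_of_constantCoeff
    (p := taylor (PowerSeries.C c) q) (m := Nat.find hex)
    (fun i hi => by
      rw [← coeff_map, hmap]; simpa using Nat.find_min hex hi)
    (by rw [← coeff_map, hmap]; exact Nat.find_spec hex)
  exact HasPuiseuxRoot.of_taylor ((ih _ hmn P hP (hPn ▸ hm0) hPn).of_dvd hPd)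

end Puiseux

section RealPuiseux

lemma exists_ramify_eq_of_rescale_eq {c : PowerSeries ℂ} {ζ : ℂ} {m : ℕ} (hm : m ≠ 0)
    (hζ : IsPrimitiveRoot ζ m) (h : PowerSeries.rescale ζ c = c) :
    ∃ b, ramify ℂ m hm b = c := by
  refine ⟨PowerSeries.mk fun n => PowerSeries.coeff (m * n) c, ?_⟩
  ext n
  rw [ramify_apply, PowerSeries.coeff_expand]
  split_ifs with hd
  · obtain ⟨k, rfl⟩ := hd
    rw [PowerSeries.coeff_mk, Nat.mul_div_cancel_left _ (Nat.pos_of_ne_zero hm)]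
  · have h1 := congrArg (PowerSeries.coeff n) h
    rw [PowerSeries.coeff_rescale] at h1
    by_contra h0
    have h2 : ζ ^ n = 1 := mul_right_cancel₀ (b := PowerSeries.coeff n c) (fun h => h0 h.symm)
      (by rw [h1, one_mul])
    exact hd ((hζ.pow_eq_one_iff_dvd n).1 h2)

lemma rescale_ramify {R : Type*} [CommRing R] {e : ℕ} (he : e ≠ 0) (a : R) (c : PowerSeries R) :
    PowerSeries.rescale a (ramify R e he c) = ramify R e he (PowerSeries.rescale (a ^ e) c) := by
  ext n
  rw [PowerSeries.coeff_rescale, ramify_apply, ramify_apply, PowerSeries.coeff_expand,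
    PowerSeries.coeff_expand]
  split_ifs with hd
  · obtain ⟨k, rfl⟩ := hd
    rw [PowerSeries.coeff_rescale, Nat.mul_div_cancel_left _ (Nat.pos_of_ne_zero he), ← pow_mul]
  · simp

lemma map_rescale {R S : Type*} [CommRing R] [CommRing S] (f : R →+* S) (a : R)
    (c : PowerSeries R) :
    PowerSeries.map f (PowerSeries.rescale a c) =
      PowerSeries.rescale (f a) (PowerSeries.map f c) := by
  ext n
  simp [PowerSeries.coeff_rescale]

lemma map_ramify {R S : Type*} [CommRing R] [CommRing S] (f : R →+* S) {e : ℕ} (he : e ≠ 0)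
    (c : PowerSeries R) :
    PowerSeries.map f (ramify R e he c) = ramify S e he (PowerSeries.map f c) :=
  PowerSeries.map_expand e he f c

/-- The inclusion of real power series into complex power series. -/
noncomputable def complexify : PowerSeries ℝ →+* PowerSeries ℂ := PowerSeries.map Complex.ofRealHom

/-- Coefficientwise complex conjugation. -/
noncomputable def conjSeries : PowerSeries ℂ →+* PowerSeries ℂ :=
  PowerSeries.map (starRingEnd ℂ)

lemma complexify_injective : Function.Injective complexify :=
  PowerSeries.map_injective _ Complex.ofReal_injective

lemma conjSeries_conjSeries (a : PowerSeries ℂ) : conjSeries (conjSeries a) = a := by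
  ext n; simp [conjSeries]

lemma conjSeries_complexify (a : PowerSeries ℝ) : conjSeries (complexify a) = complexify a := by
  ext n; simp [conjSeries, complexify]

lemma exists_complexify_eq {a : PowerSeries ℂ} (h : conjSeries a = a) : ∃ b, complexify b = a := by
  refine ⟨PowerSeries.mk fun n => (PowerSeries.coeff n a).re, ?_⟩
  ext n
  have := congrArg (PowerSeries.coeff n) h
  simp only [conjSeries, PowerSeries.coeff_map] at this
  simpa [complexify] using Complex.conj_eq_iff_re.1 this

/-- The polynomial `F` has no real root among Puiseux series in `X` or in `-X`. -/
def NoRealRoot (F : (PowerSeries ℝ)[X]) : Prop :=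
  ∀ (e : ℕ) (he : e ≠ 0) (η : ℝ), η ^ 2 = 1 → ∀ α : PowerSeries ℝ,
    F.eval₂ ((ramify ℝ e he).comp (PowerSeries.rescale η)) α ≠ 0

lemma conj_eq_of_eval₂_eq_zero {F : (PowerSeries ℝ)[X]} (hF : NoRealRoot F) {e : ℕ} (he : e ≠ 0)
    {α : PowerSeries ℂ} (hα : (F.map complexify).eval₂ (ramify ℂ e he) α = 0) {ω : ℂ}
    (hω : ω ^ e = 1) : conjSeries α ≠ PowerSeries.rescale ω α := by
  intro hc
  obtain ⟨ξ, hξ⟩ := IsAlgClosed.exists_pow_nat_eq ω (n := 2) two_pos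
  have hnorm : ‖ξ‖ = 1 := Complex.norm_eq_one_of_pow_eq_one (n := 2 * e)
    (by rw [pow_mul, hξ, hω]) (by omega)
  have hconj : (starRingEnd ℂ ξ) * ξ = 1 := by rw [Complex.conj_mul', hnorm]; simp
  have hreal : conjSeries (PowerSeries.rescale ξ α) = PowerSeries.rescale ξ α := by
    have h1 : conjSeries (PowerSeries.rescale ξ α) =
        PowerSeries.rescale (starRingEnd ℂ ξ) (conjSeries α) := map_rescale _ _ _
    rw [h1, hc, PowerSeries.rescale_rescale, ← hξ, sq, mul_assoc, mul_comm ξ (starRingEnd ℂ ξ),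
      hconj, mul_one]
  obtain ⟨β, hβ⟩ := exists_complexify_eq hreal
  have hη : (ξ ^ e) ^ 2 = 1 := by rw [← pow_mul, mul_comm, pow_mul, hξ, hω]
  obtain ⟨η, hηr, hη2⟩ : ∃ η : ℝ, (η : ℂ) = ξ ^ e ∧ η ^ 2 = 1 := by
    rcases mul_self_eq_one_iff.1 ((sq _).symm.trans hη) with h | h
    · exact ⟨1, by simp [h], by norm_num⟩
    · exact ⟨-1, by simp [h], by norm_num⟩
  apply hF e he η hη2 β
  apply complexify_injective
  have h2 := congrArg (PowerSeries.rescale ξ) hα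
  rw [eval₂_map, hom_eval₂, map_zero, ← hβ] at h2
  rw [hom_eval₂, map_zero, ← h2]
  congr 1
  ext1 a
  simp only [RingHom.comp_apply]
  rw [rescale_ramify, ← hηr]
  unfold complexify
  rw [map_ramify, map_rescale]
  rfl

lemma exists_quadratic_norm_dvd {F : (PowerSeries ℝ)[X]} (hm : F.Monic) (h0 : F.natDegree ≠ 0)
    (hF : NoRealRoot F) : ∃ q : (PowerSeries ℂ)[X], q.Monic ∧ q.natDegree ≠ 0 ∧
      q * q.map conjSeries ∣ F.map complexify := by
  classical
  have hex : ∃ e, ∃ (he : e ≠ 0) (α : PowerSeries ℂ),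
      (F.map complexify).eval₂ (ramify ℂ e he) α = 0 :=
    hasPuiseuxRoot_of_monic _ (hm.map _) (by rwa [hm.natDegree_map])
  set e := Nat.find hex
  obtain ⟨he, α, hα⟩ := Nat.find_spec hex
  have hmin : ∀ k < e, ¬ ∃ (hk : k ≠ 0) (α : PowerSeries ℂ),
      (F.map complexify).eval₂ (ramify ℂ k hk) α = 0 := fun k hk => Nat.find_min hex hk
  have hpos := Nat.pos_of_ne_zero he
  have hfix : ∀ ω : ℂ, ω ^ e = 1 → PowerSeries.rescale ω α = α → ω = 1 := by
    intro ω hω hfix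
    by_contra h1
    have hord : orderOf ω ∣ e := orderOf_dvd_of_pow_eq_one hω
    obtain ⟨k, hk⟩ := hord
    have hk0 : k ≠ 0 := by rintro rfl; omega
    have ho0 : orderOf ω ≠ 0 := by intro h; rw [h] at hk; omega
    have ho1 : orderOf ω ≠ 1 := by rwa [Ne, orderOf_eq_one_iff]
    obtain ⟨β, hβ⟩ := exists_ramify_eq_of_rescale_eq ho0 (IsPrimitiveRoot.orderOf ω) hfix
    refine hmin k ?_ ⟨hk0, β, ?_⟩
    · rw [hk]
      have : 2 ≤ orderOf ω := by omega
      nlinarith [Nat.pos_of_ne_zero hk0]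
    · apply ramify_injective ho0
      rw [hom_eval₂, hβ, map_zero, ramify_comp, ← hα]
      congr 2
      exact hk.symm
  set Z := nthRootsFinset e (1 : ℂ) with hZ
  have memZ : ∀ ζ, ζ ∈ Z ↔ ζ ^ e = 1 := fun ζ => mem_nthRootsFinset hpos 1
  have hne0 : ∀ ζ : ℂ, ζ ^ e = 1 → ζ ≠ 0 := by
    rintro ζ hζ rfl
    rw [zero_pow he] at hζ
    exact zero_ne_one hζ
  set β : ℂ → PowerSeries ℂ := fun ζ => PowerSeries.rescale ζ α with hβ
  have hββ : ∀ ζ ω, PowerSeries.rescale ω (β ζ) = β (ω * ζ) := by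
    intro ζ ω
    rw [hβ]; dsimp only
    rw [PowerSeries.rescale_rescale, mul_comm]
  have hinj : Set.InjOn β Z := by
    intro ζ hζ ω hω h
    have hζ := (memZ _).1 hζ
    have hω := (memZ _).1 hω
    have h1 := congrArg (PowerSeries.rescale ζ⁻¹) h
    rw [hββ, hββ, inv_mul_cancel₀ (hne0 _ hζ)] at h1
    have h2 := hfix (ζ⁻¹ * ω) (by rw [mul_pow, inv_pow, hζ, hω]; simp)
      (by simpa [hβ] using h1.symm)
    rwa [inv_mul_eq_one₀ (hne0 _ hζ)] at h2
  have hconjβ : ∀ ζ, conjSeries (β ζ) = PowerSeries.rescale (starRingEnd ℂ ζ) (conjSeries α) :=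
    fun ζ => map_rescale _ _ _
  have hdisj : Disjoint (Z.image β) (Z.image fun ζ => conjSeries (β ζ)) := by
    rw [Finset.disjoint_left]
    intro s hs hs'
    obtain ⟨ω, hω, rfl⟩ := Finset.mem_image.1 hs
    obtain ⟨ζ, hζ, h⟩ := Finset.mem_image.1 hs'
    rw [memZ] at hω hζ
    have hζn := Complex.norm_eq_one_of_pow_eq_one hζ he
    have hζc : (starRingEnd ℂ ζ) * ζ = 1 := by rw [Complex.conj_mul', hζn]; simp
    have h1 := congrArg (PowerSeries.rescale ζ) h
    rw [hconjβ, PowerSeries.rescale_rescale, hζc, PowerSeries.rescale_one, RingHom.id_apply,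
      hββ] at h1
    exact conj_eq_of_eval₂_eq_zero hF he hα (by rw [mul_pow, hζ, hω, one_mul]) h1
  set Q : (PowerSeries ℂ)[X] := ∏ ζ ∈ Z, (X - C (β ζ)) with hQ
  have hQm : Q.Monic := monic_prod_of_monic _ _ fun ζ _ => monic_X_sub_C _
  have hQfix : ∀ ω, ω ^ e = 1 → Q.map (PowerSeries.rescale ω) = Q := by
    intro ω hω
    rw [hQ, Polynomial.map_prod]
    simp only [Polynomial.map_sub, map_X, map_C, hββ]
    refine Finset.prod_bij (fun ζ _ => ω * ζ) ?_ ?_ ?_ ?_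
    · intro ζ hζ
      rw [memZ] at hζ ⊢
      rw [mul_pow, hω, hζ, one_mul]
    · intro a _ b _ h
      exact mul_left_cancel₀ (hne0 _ hω) h
    · intro b hb
      rw [memZ] at hb
      refine ⟨ω⁻¹ * b, ?_, mul_inv_cancel_left₀ (hne0 _ hω) b⟩
      rw [memZ, mul_pow, inv_pow, hω, hb, inv_one, one_mul]
    · intros; rfl
  have hlift : Q ∈ lifts (ramify ℂ e he) := by
    rw [lifts_iff_coeff_lifts]
    intro n
    have hprim := Complex.isPrimitiveRoot_exp e he
    obtain ⟨b, hb⟩ := exists_ramify_eq_of_rescale_eq he hprim (c := Q.coeff n) (by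
      conv_rhs => rw [← hQfix _ hprim.pow_eq_one]
      rw [coeff_map])
    exact ⟨b, hb⟩
  obtain ⟨q, hq, -, hqm⟩ := lifts_and_degree_eq_and_monic hlift hQm
  have hqd : q.natDegree = e := by
    have : (q.map (ramify ℂ e he)).natDegree = e := by
      rw [hq, hQ, natDegree_prod_of_monic _ _ fun ζ _ => monic_X_sub_C _]
      simp [hZ, (Complex.isPrimitiveRoot_exp e he).card_nthRootsFinset]
    rwa [hqm.natDegree_map] at this
  refine ⟨q, hqm, hqd ▸ he, ?_⟩
  set Fe := (F.map complexify).map (ramify ℂ e he) with hFe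
  have hFem : Fe.Monic := (hm.map _).map _
  have hroot : ∀ ζ, ζ ^ e = 1 → Fe.eval (β ζ) = 0 := by
    intro ζ hζ
    have h1 := congrArg (PowerSeries.rescale ζ) hα
    rw [hom_eval₂, map_zero] at h1
    rw [hFe, eval_map, ← h1]
    congr 1
    ext1 a
    rw [RingHom.comp_apply, rescale_ramify, hζ, PowerSeries.rescale_one, RingHom.id_apply]
  have hconjFe : Fe.map conjSeries = Fe := by
    ext1 n
    simp only [hFe, coeff_map]
    unfold conjSeries
    rw [map_ramify]
    congr 1
    exact conjSeries_complexify _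
  have hroot' : ∀ ζ, ζ ^ e = 1 → Fe.eval (conjSeries (β ζ)) = 0 := by
    intro ζ hζ
    conv_lhs => rw [← hconjFe]
    rw [eval_map, eval₂_at_apply, hroot ζ hζ, map_zero]
  have hQc : (q.map conjSeries).map (ramify ℂ e he) = Q.map conjSeries := by
    rw [← hq, Polynomial.map_map, Polynomial.map_map]
    congr 1
    ext1 a
    exact (map_ramify _ he a).symm
  have hdvd : Q * Q.map conjSeries ∣ Fe := by
    have h1 : Q * Q.map conjSeries = ((Z.image β ∪ Z.image fun ζ => conjSeries (β ζ)).val.map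
        fun a => X - C a).prod := by
      change _ = ∏ a ∈ (Z.image β ∪ Z.image fun ζ => conjSeries (β ζ)), (X - C a)
      rw [Finset.prod_union hdisj, Finset.prod_image hinj, Finset.prod_image, hQ,
        Polynomial.map_prod]
      · simp
      · intro a ha b hb h
        apply hinj ha hb
        have := congrArg conjSeries h
        rwa [conjSeries_conjSeries, conjSeries_conjSeries] at this
    rw [h1, Multiset.prod_X_sub_C_dvd_iff_le_roots hFem.ne_zero, Multiset.le_iff_subset
      (Finset.nodup _)]
    intro s hs
    rw [mem_roots hFem.ne_zero]
    rw [Finset.mem_val, Finset.mem_union, Finset.mem_image, Finset.mem_image] at hs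
    rcases hs with ⟨ζ, hζ, rfl⟩ | ⟨ζ, hζ, rfl⟩
    · exact hroot ζ ((memZ _).1 hζ)
    · exact hroot' ζ ((memZ _).1 hζ)
  rw [← hQc, ← hq, ← Polynomial.map_mul] at hdvd
  have hmm : (q * q.map conjSeries).Monic := hqm.mul (hqm.map _)
  rw [← modByMonic_eq_zero_iff_dvd hmm]
  apply Polynomial.map_injective _ (ramify_injective he)
  rw [map_modByMonic _ hmm, Polynomial.map_zero, modByMonic_eq_zero_iff_dvd (hmm.map _)]
  exact hdvd

lemma exists_monic_norm_eq (F : (PowerSeries ℝ)[X]) (hm : F.Monic) (hF : NoRealRoot F) :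
    ∃ q : (PowerSeries ℂ)[X], q.Monic ∧ F.map complexify = q * q.map conjSeries := by
  induction hN : F.natDegree using Nat.strong_induction_on generalizing F with
  | _ N ih =>
  by_cases h0 : F.natDegree = 0
  · exact ⟨1, monic_one, by rw [hm.natDegree_eq_zero.1 h0]; simp⟩
  obtain ⟨q, hq, hq0, hdvd⟩ := exists_quadratic_norm_dvd hm h0 hF
  have hmm : (q * q.map conjSeries).Monic := hq.mul (hq.map _)
  have hlift : q * q.map conjSeries ∈ lifts complexify := by
    rw [lifts_iff_coeff_lifts]
    intro n
    obtain ⟨b, hb⟩ := exists_complexify_eq (a := (q * q.map conjSeries).coeff n) (by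
      rw [← coeff_map, Polynomial.map_mul, Polynomial.map_map]
      have : conjSeries.comp conjSeries = RingHom.id _ := RingHom.ext conjSeries_conjSeries
      rw [this, Polynomial.map_id, mul_comm])
    exact ⟨b, hb⟩
  obtain ⟨G, hG, -, hGm⟩ := lifts_and_degree_eq_and_monic hlift hmm
  have hGF : G ∣ F := by
    rw [← modByMonic_eq_zero_iff_dvd hGm]
    apply Polynomial.map_injective _ complexify_injective
    rw [map_modByMonic _ hGm, Polynomial.map_zero, modByMonic_eq_zero_iff_dvd (hGm.map _), hG]
    exact hdvd
  obtain ⟨F', rfl⟩ := hGF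
  have hF'm := hGm.of_mul_monic_left hm
  have hGd : G.natDegree = q.natDegree + q.natDegree := by
    rw [← hGm.natDegree_map complexify, hG, hq.natDegree_mul (hq.map _), hq.natDegree_map]
  obtain ⟨q', hq', h'⟩ := ih F'.natDegree (by rw [← hN, hGm.natDegree_mul hF'm]; omega) F' hF'm
    (fun e he η hη α h => hF e he η hη α (by rw [eval₂_mul, h, mul_zero])) rfl
  exact ⟨q * q', hq.mul hq', by rw [Polynomial.map_mul, hG, h', Polynomial.map_mul]; ring⟩

theorem eq_sq_add_sq_of_noRealRoot (F : (PowerSeries ℝ)[X]) (hm : F.Monic) (hF : NoRealRoot F) :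
    ∃ A B : (PowerSeries ℝ)[X], 2 * A.natDegree ≤ F.natDegree ∧ 2 * B.natDegree ≤ F.natDegree ∧
      F = A ^ 2 + B ^ 2 := by
  obtain ⟨q, hq, h⟩ := exists_monic_norm_eq F hm hF
  have hd : F.natDegree = q.natDegree + q.natDegree := by
    rw [← hm.natDegree_map complexify, h, hq.natDegree_mul (hq.map _), hq.natDegree_map]
  set re : PowerSeries ℂ → PowerSeries ℝ := fun a =>
    PowerSeries.mk fun n => (PowerSeries.coeff n a).re with hre
  set im : PowerSeries ℂ → PowerSeries ℝ := fun a =>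
    PowerSeries.mk fun n => (PowerSeries.coeff n a).im with him
  set A : (PowerSeries ℝ)[X] := ∑ i ∈ Finset.range (q.natDegree + 1), monomial i (re (q.coeff i))
  set B : (PowerSeries ℝ)[X] := ∑ i ∈ Finset.range (q.natDegree + 1), monomial i (im (q.coeff i))
  have hre0 : re 0 = 0 := by ext n; simp [hre]
  have him0 : im 0 = 0 := by ext n; simp [him]
  have hA : ∀ i, A.coeff i = re (q.coeff i) := by
    intro i
    simp only [A, finsetSum_coeff, coeff_monomial, Finset.sum_ite_eq', Finset.mem_range]
    split_ifs with hi
    · rfl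
    · rw [coeff_eq_zero_of_natDegree_lt (by omega), hre0]
  have hB : ∀ i, B.coeff i = im (q.coeff i) := by
    intro i
    simp only [B, finsetSum_coeff, coeff_monomial, Finset.sum_ite_eq', Finset.mem_range]
    split_ifs with hi
    · rfl
    · rw [coeff_eq_zero_of_natDegree_lt (by omega), him0]
  set I : (PowerSeries ℂ)[X] := C (PowerSeries.C Complex.I) with hI
  have hII : I ^ 2 = -1 := by
    rw [hI, ← C_pow, ← map_pow, Complex.I_sq]; simp
  have hq1 : q = A.map complexify + I * B.map complexify := by
    ext i n
    rw [coeff_add, hI, coeff_C_mul, coeff_map, coeff_map, hA, hB]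
    simp [complexify, hre, him, mul_comm Complex.I]
  have hq2 : q.map conjSeries = A.map complexify - I * B.map complexify := by
    ext i n
    rw [coeff_sub, hI, coeff_C_mul, coeff_map, coeff_map, coeff_map, hA, hB]
    simp only [complexify, conjSeries, hre, him, map_sub, PowerSeries.coeff_map,
      PowerSeries.coeff_C_mul, PowerSeries.coeff_mk]
    apply Complex.ext <;> simp
  refine ⟨A, B, ?_, ?_, ?_⟩
  · have : A.natDegree ≤ q.natDegree := natDegree_le_iff_coeff_eq_zero.2 fun i hi => by
      rw [hA, coeff_eq_zero_of_natDegree_lt (by omega), hre0]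
    omega
  · have : B.natDegree ≤ q.natDegree := natDegree_le_iff_coeff_eq_zero.2 fun i hi => by
      rw [hB, coeff_eq_zero_of_natDegree_lt (by omega), him0]
    omega
  · apply Polynomial.map_injective _ complexify_injective
    rw [h, hq2]
    nth_rw 1 [hq1]
    rw [Polynomial.map_add, Polynomial.map_pow, Polynomial.map_pow]
    linear_combination (-(B.map complexify) ^ 2) * hII

end RealPuiseux

section StripCone

/-- Substitution of a univariate polynomial for the first variable. -/
noncomputable def baseChange (φ : ℝ[X]) : ℝ[X][Y] →+* ℝ[X][Y] := mapRingHom (compRingHom φ)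

lemma coeff_baseChange (φ : ℝ[X]) (f : ℝ[X][Y]) (i : ℕ) :
    (baseChange φ f).coeff i = (f.coeff i).comp φ := by
  simp [baseChange]

lemma baseChange_C (φ p : ℝ[X]) : baseChange φ (C p) = C (p.comp φ) := by
  simp [baseChange]

lemma natDegree_baseChange_le (φ : ℝ[X]) (f : ℝ[X][Y]) :
    (baseChange φ f).natDegree ≤ f.natDegree := natDegree_map_le

lemma baseChange_baseChange (φ ψ : ℝ[X]) (f : ℝ[X][Y]) :
    baseChange φ (baseChange ψ f) = baseChange (ψ.comp φ) f := by
  ext1 i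
  simp [coeff_baseChange, comp_assoc]

lemma baseChange_X (f : ℝ[X][Y]) : baseChange X f = f := by
  ext1 i
  simp [coeff_baseChange]

lemma evalEval_baseChange (φ : ℝ[X]) (f : ℝ[X][Y]) (x y : ℝ) :
    (baseChange φ f).evalEval x y = f.evalEval (φ.eval x) y := by
  rw [← eval₂_evalRingHom, ← eval₂_evalRingHom, baseChange, coe_mapRingHom, eval₂_map]
  congr 1
  ext p <;> simp

/-- Sums of polynomials `p(X) g(X,Y) ^ 2` with `p` nonnegative on `[0,1]` and `g` of degree at
most `d` in `Y`. -/
noncomputable def stripCone (d : ℕ) : AddSubmonoid ℝ[X][Y] :=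
  AddSubmonoid.closure {P | ∃ (p : ℝ[X]) (g : ℝ[X][Y]), (∀ x ∈ Set.Icc (0 : ℝ) 1, 0 ≤ p.eval x) ∧
    g.natDegree ≤ d ∧ P = C p * g ^ 2}

lemma C_mul_sq_mem_stripCone {d : ℕ} {p : ℝ[X]} {g : ℝ[X][Y]}
    (hp : ∀ x ∈ Set.Icc (0 : ℝ) 1, 0 ≤ p.eval x) (hg : g.natDegree ≤ d) :
    C p * g ^ 2 ∈ stripCone d :=
  AddSubmonoid.subset_closure ⟨p, g, hp, hg, rfl⟩

lemma map_mem_stripCone {d d' : ℕ} (φ : ℝ[X][Y] →+ ℝ[X][Y])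
    (h : ∀ (p : ℝ[X]) (g : ℝ[X][Y]), (∀ x ∈ Set.Icc (0 : ℝ) 1, 0 ≤ p.eval x) → g.natDegree ≤ d →
      φ (C p * g ^ 2) ∈ stripCone d') {f : ℝ[X][Y]} (hf : f ∈ stripCone d) :
    φ f ∈ stripCone d' := by
  have : stripCone d ≤ (stripCone d').comap φ := by
    refine AddSubmonoid.closure_le.2 ?_
    rintro _ ⟨p, g, hp, hg, rfl⟩
    exact h p g hp hg
  exact this hf

lemma stripCone_mono {d d' : ℕ} (h : d ≤ d') : stripCone d ≤ stripCone d' := fun _ hf =>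
  map_mem_stripCone (AddMonoidHom.id _) (fun _ _ hp hg => C_mul_sq_mem_stripCone hp (hg.trans h)) hf

lemma C_mul_mem_stripCone {d : ℕ} {p : ℝ[X]} (hp : ∀ x ∈ Set.Icc (0 : ℝ) 1, 0 ≤ p.eval x)
    {f : ℝ[X][Y]} (hf : f ∈ stripCone d) : C p * f ∈ stripCone d :=
  map_mem_stripCone (AddMonoidHom.mulLeft (C p)) (fun q g hq hg => by
    rw [AddMonoidHom.coe_mulLeft, ← mul_assoc, ← C_mul]
    exact C_mul_sq_mem_stripCone (fun x hx => by
      rw [eval_mul]; exact mul_nonneg (hp x hx) (hq x hx)) hg) hf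

lemma sq_mul_mem_stripCone {d k : ℕ} {q : ℝ[X][Y]} (hq : q.natDegree ≤ k)
    {f : ℝ[X][Y]} (hf : f ∈ stripCone d) : q ^ 2 * f ∈ stripCone (d + k) :=
  map_mem_stripCone (AddMonoidHom.mulLeft (q ^ 2)) (fun p g hp hg => by
    rw [AddMonoidHom.coe_mulLeft]
    have : q ^ 2 * (C p * g ^ 2) = C p * (g * q) ^ 2 := by ring
    rw [this]
    exact C_mul_sq_mem_stripCone hp (natDegree_mul_le.trans (add_le_add hg hq))) hf

lemma baseChange_mem_stripCone {d : ℕ} {φ : ℝ[X]}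
    (hφ : ∀ x ∈ Set.Icc (0 : ℝ) 1, φ.eval x ∈ Set.Icc (0 : ℝ) 1) {f : ℝ[X][Y]}
    (hf : f ∈ stripCone d) : baseChange φ f ∈ stripCone d :=
  map_mem_stripCone (baseChange φ : ℝ[X][Y] →+ ℝ[X][Y]) (fun p g hp hg => by
    rw [AddMonoidHom.coe_coe, map_mul, map_pow, baseChange_C]
    exact C_mul_sq_mem_stripCone (fun x hx => by rw [eval_comp]; exact hp _ (hφ x hx))
      ((natDegree_baseChange_le _ _).trans hg)) hf

lemma natDegree_le_of_mem_stripCone {d : ℕ} {f : ℝ[X][Y]} (hf : f ∈ stripCone d) :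
    f.natDegree ≤ 2 * d := by
  induction hf using AddSubmonoid.closure_induction with
  | mem f h =>
    obtain ⟨p, g, -, hg, rfl⟩ := h
    refine (natDegree_C_mul_le _ _).trans (natDegree_pow_le.trans ?_)
    omega
  | zero => simp
  | add f g _ _ h1 h2 => exact (natDegree_add_le _ _).trans (max_le h1 h2)

end StripCone

section Local

lemma X_pow_dvd_of_coe {p : ℝ[X]} {n : ℕ}
    (h : (PowerSeries.X : PowerSeries ℝ) ^ n ∣ (p : PowerSeries ℝ)) : X ^ n ∣ p := by
  rw [X_pow_dvd_iff]
  intro d hd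
  simpa using PowerSeries.X_pow_dvd_iff.1 h d hd

lemma X_pow_dvd_sub_trunc (a : PowerSeries ℝ) (n : ℕ) :
    (PowerSeries.X : PowerSeries ℝ) ^ n ∣ a - (PowerSeries.trunc n a : ℝ[X]) := by
  rw [PowerSeries.X_pow_dvd_iff]
  intro m hm
  simp [PowerSeries.coeff_trunc, hm]

/-- A strictly positive lower bound excludes Puiseux roots. -/
lemma noRealRoot_of_lower_bound {f : ℝ[X][Y]} {D : ℝ[X]} (hD : D ≠ 0) {δ : ℝ} (hδ : 0 < δ)
    (hf : ∀ x, |x| < δ → ∀ y, (D.eval x) ^ 2 ≤ f.evalEval x y) :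
    NoRealRoot (f.map coeToPowerSeries.ringHom) := by
  intro e he η hη α hα
  have hη0 : η ≠ 0 := by rintro rfl; norm_num at hη
  set φ : ℝ[X] := C η * X ^ e with hφ
  set K : ℝ[X] := (D.comp φ) ^ 2 with hK
  have hφd : φ.natDegree = e := by rw [hφ, natDegree_C_mul_X_pow _ _ hη0]
  have hK0 : K ≠ 0 := by
    refine pow_ne_zero _ fun h => ?_
    rcases comp_eq_zero_iff.1 h with h | ⟨-, h⟩
    · exact hD h
    · have := congrArg natDegree h
      rw [hφd, natDegree_C] at this
      exact he this
  obtain ⟨K₁, hK₁, hK₁0⟩ := exists_eq_pow_rootMultiplicity_mul_and_not_dvd K hK0 0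
  set m := K.rootMultiplicity 0
  rw [C_0, sub_zero] at hK₁ hK₁0
  set αn := PowerSeries.trunc (m + 1) α with hαn
  set G : ℝ[X] := f.eval₂ (compRingHom φ) αn with hG
  have hhom : coeToPowerSeries.ringHom.comp (compRingHom φ) =
      ((ramify ℝ e he).comp (PowerSeries.rescale η)).comp coeToPowerSeries.ringHom := by
    apply Polynomial.ringHom_ext
    · intro a
      simp only [RingHom.comp_apply, coe_compRingHom_apply, C_comp,
        coeToPowerSeries.ringHom_apply, coe_C, ramify_apply]
      have : PowerSeries.rescale η (PowerSeries.C a) = PowerSeries.C a := by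
        ext n
        rw [PowerSeries.coeff_rescale, PowerSeries.coeff_C]
        split_ifs with h <;> simp [h]
      rw [this, PowerSeries.expand_C]
    · simp only [RingHom.comp_apply, coe_compRingHom_apply, X_comp,
        coeToPowerSeries.ringHom_apply, coe_X, ramify_apply, hφ, PowerSeries.rescale_X]
      rw [map_mul, PowerSeries.expand_C, PowerSeries.expand_X]
      simp
  have hGdvd : X ^ (m + 1) ∣ G := by
    apply X_pow_dvd_of_coe
    rw [← coeToPowerSeries.ringHom_apply, hG, hom_eval₂, hhom, ← eval₂_map]
    have h1 := sub_dvd_eval_sub α (coeToPowerSeries.ringHom αn)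
      ((f.map coeToPowerSeries.ringHom).map ((ramify ℝ e he).comp (PowerSeries.rescale η)))
    rw [eval_map, eval_map, hα, zero_sub, dvd_neg] at h1
    exact (X_pow_dvd_sub_trunc α (m + 1)).trans h1
  obtain ⟨G₁, hG₁⟩ := hGdvd
  have hGe : ∀ w, G.eval w = f.evalEval (φ.eval w) (αn.eval w) := by
    intro w
    rw [hG, ← coe_evalRingHom, hom_eval₂, ← eval₂_evalRingHom]
    congr 1
    ext p <;> simp
  have hK₁pos : 0 < K₁.eval 0 := by
    have h1 : K₁.eval 0 ≠ 0 := fun h => hK₁0 (by simpa using dvd_iff_isRoot.2 h)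
    refine lt_of_le_of_ne ?_ h1.symm
    refine ge_of_tendsto (K₁.continuous.continuousAt.mono_left
      (nhdsWithin_le_nhds (s := Set.Ioi (0 : ℝ)))) ?_
    filter_upwards [self_mem_nhdsWithin] with w hw
    have hw : 0 < w := hw
    have h2 : 0 ≤ K.eval w := by rw [hK, eval_pow]; positivity
    rw [hK₁, eval_mul, eval_pow, eval_X] at h2
    exact nonneg_of_mul_nonneg_right h2 (by positivity)
  have hle : K₁.eval 0 ≤ (X * G₁).eval 0 := by
    refine le_of_tendsto_of_tendsto (K₁.continuous.continuousAt.mono_left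
      (nhdsWithin_le_nhds (s := Set.Ioi (0 : ℝ)))) ((X * G₁).continuous.continuousAt.mono_left
      (nhdsWithin_le_nhds (s := Set.Ioi (0 : ℝ)))) ?_
    have hev : ∀ᶠ w in nhdsWithin (0 : ℝ) (Set.Ioi 0), |φ.eval w| < δ := by
      have : Filter.Tendsto (fun w => |φ.eval w|) (nhdsWithin (0 : ℝ) (Set.Ioi 0)) (nhds 0) := by
        have h2 : |φ.eval 0| = 0 := by simp [hφ, he]
        have h3 : Filter.Tendsto (fun w => |φ.eval w|) (nhds 0) (nhds |φ.eval 0|) :=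
          φ.continuous.abs.continuousAt
        rw [h2] at h3
        exact h3.mono_left nhdsWithin_le_nhds
      exact this.eventually (gt_mem_nhds hδ)
    filter_upwards [hev, self_mem_nhdsWithin] with w hw hw0
    have hw0 : 0 < w := hw0
    have h1 := hf _ hw (αn.eval w)
    rw [← hGe, ← eval_comp, ← eval_pow, ← hK, hK₁, hG₁, eval_mul, eval_mul, eval_pow, eval_pow,
      eval_X, pow_succ, mul_assoc] at h1
    have h2 := le_of_mul_le_mul_left h1 (by positivity)
    simpa using h2
  simp at hle
  linarith

lemma exists_polynomial_approx (A : (PowerSeries ℝ)[X]) (n : ℕ) :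
    ∃ B : ℝ[X][Y], B.natDegree ≤ A.natDegree ∧
      C ((PowerSeries.X : PowerSeries ℝ) ^ n) ∣ A - B.map coeToPowerSeries.ringHom := by
  set B : ℝ[X][Y] := ∑ i ∈ Finset.range (A.natDegree + 1),
    monomial i (PowerSeries.trunc n (A.coeff i))
  have hB : ∀ i, B.coeff i = PowerSeries.trunc n (A.coeff i) := by
    intro i
    simp only [B, finsetSum_coeff, coeff_monomial, Finset.sum_ite_eq', Finset.mem_range]
    split_ifs with hi
    · rfl
    · rw [coeff_eq_zero_of_natDegree_lt (by omega), map_zero]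
  refine ⟨B, natDegree_le_iff_coeff_eq_zero.2 fun i hi => by
    rw [hB, coeff_eq_zero_of_natDegree_lt hi, map_zero], ?_⟩
  rw [C_dvd_iff_dvd_coeff]
  intro i
  rw [coeff_sub, coeff_map, hB]
  exact X_pow_dvd_sub_trunc _ _

/-- Near the origin, a polynomial with a lower bound is a positive multiple of a sum of two
squares modulo powers of `X`. -/
lemma exists_local_sq_add_sq {f : ℝ[X][Y]} {d : ℕ} (hd : f.natDegree ≤ 2 * d)
    (ha : (f.coeff (2 * d)).eval 0 ≠ 0) {D : ℝ[X]} (hD : D ≠ 0) {δ : ℝ} (hδ : 0 < δ)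
    (hf : ∀ x, |x| < δ → ∀ y, (D.eval x) ^ 2 ≤ f.evalEval x y) (n : ℕ) :
    ∃ A B : ℝ[X][Y], A.natDegree ≤ d ∧ B.natDegree ≤ d ∧
      C (X ^ n) ∣ f - C (f.coeff (2 * d)) * (A ^ 2 + B ^ 2) := by
  set a := f.coeff (2 * d) with ha_def
  set ι := coeToPowerSeries.ringHom (R := ℝ) with hι
  obtain ⟨u, hu⟩ : IsUnit (ι a) := by
    rw [PowerSeries.isUnit_iff_constantCoeff]
    rw [hι, coeToPowerSeries.ringHom_apply, constantCoeff_coe,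
      coeff_zero_eq_eval_zero]
    exact isUnit_iff_ne_zero.2 ha
  set F : (PowerSeries ℝ)[X] := C (↑u⁻¹ : PowerSeries ℝ) * f.map ι with hF
  have hFd : F.natDegree ≤ 2 * d :=
    (natDegree_C_mul_le _ _).trans (natDegree_map_le.trans hd)
  have hFc : F.coeff (2 * d) = 1 := by
    rw [hF, coeff_C_mul, coeff_map, ← ha_def, ← hu, Units.inv_mul]
  have hFm : F.Monic := monic_of_natDegree_le_of_coeff_eq_one _ hFd hFc
  have hfF : f.map ι = C (ι a) * F := by
    rw [hF, ← mul_assoc, ← C_mul, ← hu, Units.mul_inv, C_1, one_mul]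
  have hroot := noRealRoot_of_lower_bound hD hδ hf
  obtain ⟨A', B', hA', hB', hAB⟩ := eq_sq_add_sq_of_noRealRoot F hFm (fun e he η hη α h => by
    apply hroot e he η hη α
    rw [← hι, hfF, eval₂_mul, h, mul_zero])
  obtain ⟨A, hAd, hA⟩ := exists_polynomial_approx A' n
  obtain ⟨B, hBd, hB⟩ := exists_polynomial_approx B' n
  refine ⟨A, B, by omega, by omega, ?_⟩
  rw [C_dvd_iff_dvd_coeff]
  intro i
  apply X_pow_dvd_of_coe
  have h1 : C ((PowerSeries.X : PowerSeries ℝ) ^ n) ∣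
      (f - C a * (A ^ 2 + B ^ 2)).map ι := by
    obtain ⟨s, hs⟩ := hA
    obtain ⟨t, ht⟩ := hB
    rw [Polynomial.map_sub, hfF, hAB, Polynomial.map_mul, Polynomial.map_add, Polynomial.map_pow,
      Polynomial.map_pow, map_C]
    refine ⟨C (ι a) * (s * (A' + A.map ι) + t * (B' + B.map ι)), ?_⟩
    linear_combination (C (ι a) * (A' + A.map ι)) * hs + (C (ι a) * (B' + B.map ι)) * ht
  have h2 := (C_dvd_iff_dvd_coeff _ _).1 h1 i
  rwa [coeff_map] at h2

lemma exists_even_odd (A : ℝ[X][Y]) : ∃ A₀ A₁ : ℝ[X][Y], A₀.natDegree ≤ A.natDegree ∧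
    A₁.natDegree ≤ A.natDegree ∧
    A = baseChange (X ^ 2) A₀ + C X * baseChange (X ^ 2) A₁ := by
  have hsplit : ∀ p : ℝ[X], p = expand ℝ 2 (contract 2 p) + X * expand ℝ 2 (contract 2 p.divX) := by
    intro p
    ext n
    rw [coeff_add, coeff_expand two_pos, coeff_contract two_ne_zero]
    rcases Nat.even_or_odd' n with ⟨k, rfl | rfl⟩
    · rw [if_pos (dvd_mul_right _ _), Nat.mul_div_cancel_left _ two_pos, mul_comm k]
      rcases k with - | k
      · simp
      · have : 2 * (k + 1) = 2 * k + 1 + 1 := by ring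
        rw [this, coeff_X_mul, coeff_expand two_pos, if_neg (by omega), add_zero]
    · rw [if_neg (by omega), coeff_X_mul, coeff_expand two_pos, if_pos (dvd_mul_right _ _),
        Nat.mul_div_cancel_left _ two_pos, coeff_contract two_ne_zero, coeff_divX, zero_add,
        mul_comm k]
  have hc0 : contract 2 (0 : ℝ[X]) = 0 := by ext n; simp [coeff_contract]
  have hco : ∀ (g : ℝ[X] → ℝ[X]), g 0 = 0 → ∃ B : ℝ[X][Y], B.natDegree ≤ A.natDegree ∧
      ∀ i, B.coeff i = g (A.coeff i) := by
    intro g hg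
    have hB : ∀ i, (∑ i ∈ Finset.range (A.natDegree + 1), monomial i (g (A.coeff i))).coeff i =
        g (A.coeff i) := by
      intro i
      simp only [finsetSum_coeff, coeff_monomial, Finset.sum_ite_eq', Finset.mem_range]
      split_ifs with hi
      · rfl
      · rw [coeff_eq_zero_of_natDegree_lt (by omega), hg]
    exact ⟨_, natDegree_le_iff_coeff_eq_zero.2 fun i hi => by
      rw [hB, coeff_eq_zero_of_natDegree_lt hi, hg], hB⟩
  obtain ⟨A₀, h₀, hA₀⟩ := hco (contract 2) hc0
  obtain ⟨A₁, h₁, hA₁⟩ := hco (fun p => contract 2 p.divX) (by rw [divX_zero, hc0])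
  refine ⟨A₀, A₁, h₀, h₁, ?_⟩
  ext1 i
  rw [coeff_add, coeff_C_mul, coeff_baseChange, coeff_baseChange, hA₀, hA₁,
    ← expand_eq_comp_X_pow, ← expand_eq_comp_X_pow]
  exact hsplit _

lemma exists_local_zero {f : ℝ[X][Y]} {d : ℕ} (hd : f.natDegree ≤ 2 * d)
    (ha : ∀ x ∈ Set.Icc (0 : ℝ) 1, 0 < (f.coeff (2 * d)).eval x) {D : ℝ[X]} (hD : D ≠ 0)
    (hf : ∀ x ∈ Set.Icc (0 : ℝ) 1, ∀ y, (D.eval x) ^ 2 ≤ f.evalEval x y) (n : ℕ) :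
    ∃ σ ∈ stripCone d, C (X ^ n) ∣ f - σ := by
  have hsq : ∀ x : ℝ, |x| < 1 → x ^ 2 ∈ Set.Icc (0 : ℝ) 1 := fun x hx =>
    ⟨sq_nonneg x, by rw [← sq_abs]; nlinarith [abs_nonneg x]⟩
  have hD' : D.comp (X ^ 2) ≠ 0 := by
    rw [← expand_eq_comp_X_pow]; exact (expand_ne_zero two_pos).2 hD
  obtain ⟨A, B, hA, hB, hAB⟩ := exists_local_sq_add_sq (f := baseChange (X ^ 2) f) (d := d)
    ((natDegree_baseChange_le _ _).trans hd)
    (by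
      rw [coeff_baseChange, eval_comp]
      exact (ha _ (by simp)).ne') hD' one_pos
    (fun x hx y => by
      rw [evalEval_baseChange, eval_comp]
      refine hf _ ?_ y
      simpa using hsq x hx) (2 * n)
  set a := f.coeff (2 * d) with ha_def
  rw [coeff_baseChange, ← ha_def] at hAB
  obtain ⟨A₀, A₁, hA₀, hA₁, rfl⟩ := exists_even_odd A
  obtain ⟨B₀, B₁, hB₀, hB₁, rfl⟩ := exists_even_odd B
  set E := baseChange (X ^ 2) with hE
  have hann : ∀ x ∈ Set.Icc (0 : ℝ) 1, 0 ≤ a.eval x := fun x hx => (ha x hx).le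
  have hxann : ∀ x ∈ Set.Icc (0 : ℝ) 1, 0 ≤ (X * a).eval x := fun x hx => by
    rw [eval_mul, eval_X]; exact mul_nonneg hx.1 (hann x hx)
  refine ⟨C a * A₀ ^ 2 + C a * B₀ ^ 2 + (C (X * a) * A₁ ^ 2 + C (X * a) * B₁ ^ 2),
    add_mem (add_mem (C_mul_sq_mem_stripCone hann (hA₀.trans hA))
      (C_mul_sq_mem_stripCone hann (hB₀.trans hB)))
      (add_mem (C_mul_sq_mem_stripCone hxann (hA₁.trans hA))
      (C_mul_sq_mem_stripCone hxann (hB₁.trans hB))), ?_⟩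
  set τ := f - (C a * A₀ ^ 2 + C a * B₀ ^ 2 + (C (X * a) * A₁ ^ 2 + C (X * a) * B₁ ^ 2))
    with hτ
  have hneg : ∀ g, baseChange (-X) (E g) = E g := by
    intro g
    rw [hE, baseChange_baseChange]
    simp
  have hdvd : C (X ^ (2 * n)) ∣ E τ := by
    obtain ⟨s, hs⟩ := hAB
    have hs' := congrArg (baseChange (-X)) hs
    simp only [map_sub, map_mul, map_add, map_pow, hneg, baseChange_C] at hs hs'
    have h1 : (a.comp (X ^ 2)).comp (-X) = a.comp (X ^ 2) := by
      rw [comp_assoc]; simp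
    rw [h1] at hs'
    simp only [X_comp, C_neg] at hs'
    rw [show (-(C X : ℝ[X][Y])) ^ (2 * n) = C X ^ (2 * n) by
      rw [← C_neg, ← C_pow, ← C_pow, (even_two_mul n).neg_pow]] at hs'
    refine ⟨C (C (1 / 2)) * (s + baseChange (-X) s), ?_⟩
    have h2 : (C (C (1 / 2)) : ℝ[X][Y]) * 2 = 1 := by
      have : (2 : ℝ[X][Y]) = C (C 2) := rfl
      rw [this, ← C_mul, ← C_mul]; norm_num
    rw [hτ]
    simp only [map_sub, map_mul, map_add, map_pow, hE, baseChange_C, X_comp]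
    simp only [hE] at hs hs'
    linear_combination (C (C (1 / 2))) * hs + (C (C (1 / 2))) * hs' -
      (baseChange (X ^ 2) f - (C (a.comp (X ^ 2)) * (baseChange (X ^ 2) A₀) ^ 2 +
        C (a.comp (X ^ 2)) * (baseChange (X ^ 2) B₀) ^ 2 +
        (C X ^ 2 * C (a.comp (X ^ 2)) * (baseChange (X ^ 2) A₁) ^ 2 +
        C X ^ 2 * C (a.comp (X ^ 2)) * (baseChange (X ^ 2) B₁) ^ 2))) * h2
  rw [C_dvd_iff_dvd_coeff] at hdvd ⊢
  intro i
  have h := hdvd i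
  rw [hE, coeff_baseChange, ← expand_eq_comp_X_pow, X_pow_dvd_iff] at h
  rw [X_pow_dvd_iff]
  intro k hk
  have := h (2 * k) (by omega)
  rwa [mul_comm, coeff_expand_mul two_pos] at this

lemma exists_local {f : ℝ[X][Y]} {d : ℕ} (hd : f.natDegree ≤ 2 * d)
    (ha : ∀ x ∈ Set.Icc (0 : ℝ) 1, 0 < (f.coeff (2 * d)).eval x) {D : ℝ[X]} (hD : D ≠ 0)
    (hf : ∀ x ∈ Set.Icc (0 : ℝ) 1, ∀ y, (D.eval x) ^ 2 ≤ f.evalEval x y) {r : ℝ}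
    (hr : r ∈ Set.Icc (0 : ℝ) 1) (n : ℕ) :
    ∃ σ ∈ stripCone d, C ((X - C r) ^ n) ∣ f - σ := by
  rcases eq_or_lt_of_le hr.1 with rfl | hr0
  · simpa using exists_local_zero hd ha hD hf n
  rcases eq_or_lt_of_le hr.2 with rfl | hr1
  · have hflip : ∀ x ∈ Set.Icc (0 : ℝ) 1, (1 - X : ℝ[X]).eval x ∈ Set.Icc (0 : ℝ) 1 := by
      intro x hx
      simp only [eval_sub, eval_one, eval_X, Set.mem_Icc] at hx ⊢
      constructor <;> linarith [hx.1, hx.2]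
    have hinv : (1 - X : ℝ[X]).comp (1 - X) = X := by simp
    obtain ⟨σ, hσ, s, hs⟩ := exists_local_zero (f := baseChange (1 - X) f) (d := d)
      ((natDegree_baseChange_le _ _).trans hd)
      (fun x hx => by rw [coeff_baseChange, eval_comp]; exact ha _ (hflip x hx))
      (D := D.comp (1 - X)) (fun h => hD (by
        have := congrArg (fun p => p.comp (1 - X)) h
        simpa [comp_assoc, hinv] using this))
      (fun x hx y => by rw [evalEval_baseChange, eval_comp]; exact hf _ (hflip x hx) y) n
    refine ⟨baseChange (1 - X) σ, baseChange_mem_stripCone hflip hσ,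
      C ((-1) ^ n) * baseChange (1 - X) s, ?_⟩
    have h := congrArg (baseChange (1 - X)) hs
    rw [map_sub, baseChange_baseChange, hinv, baseChange_X, map_mul, baseChange_C] at h
    rw [h, ← mul_assoc, ← C_mul, ← mul_pow]
    congr 2
    simp
  obtain ⟨A, B, hA, hB, s, hs⟩ := exists_local_sq_add_sq (f := baseChange (X + C r) f) (d := d)
    ((natDegree_baseChange_le _ _).trans hd)
    (by
      rw [coeff_baseChange, eval_comp]
      exact (ha _ (by simpa using hr)).ne')
    (D := D.comp (X + C r)) (fun h => hD (by
        have := congrArg (fun p => p.comp (X - C r)) h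
        simpa [comp_assoc] using this)) (lt_min hr0 (sub_pos.2 hr1))
    (fun x hx y => by
      rw [evalEval_baseChange, eval_comp]
      refine hf _ ?_ y
      have h1 := abs_lt.1 hx
      have h2 := min_le_left r (1 - r)
      have h3 := min_le_right r (1 - r)
      simp only [eval_add, eval_X, eval_C, Set.mem_Icc]
      constructor <;> linarith [h1.1, h1.2]) n
  have hann : ∀ x ∈ Set.Icc (0 : ℝ) 1, 0 ≤ (f.coeff (2 * d)).eval x := fun x hx => (ha x hx).le
  refine ⟨C (f.coeff (2 * d)) * (baseChange (X - C r) A) ^ 2 +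
    C (f.coeff (2 * d)) * (baseChange (X - C r) B) ^ 2,
    add_mem (C_mul_sq_mem_stripCone hann ((natDegree_baseChange_le _ _).trans hA))
      (C_mul_sq_mem_stripCone hann ((natDegree_baseChange_le _ _).trans hB)),
    baseChange (X - C r) s, ?_⟩
  have h := congrArg (baseChange (X - C r)) hs
  have hinv : (X + C r : ℝ[X]).comp (X - C r) = X := by simp
  rw [map_sub, baseChange_baseChange, hinv, baseChange_X, map_mul, map_mul, baseChange_C,
    baseChange_C, coeff_baseChange, comp_assoc, hinv, comp_X, map_add, map_pow, map_pow, pow_comp,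
    X_comp] at h
  rw [← h]
  ring

lemma exists_semilocal {f : ℝ[X][Y]} {d : ℕ} (hd : f.natDegree ≤ 2 * d)
    (ha : ∀ x ∈ Set.Icc (0 : ℝ) 1, 0 < (f.coeff (2 * d)).eval x) {D : ℝ[X]} (hD : D ≠ 0)
    (hf : ∀ x ∈ Set.Icc (0 : ℝ) 1, ∀ y, (D.eval x) ^ 2 ≤ f.evalEval x y) (n : ℕ)
    (S : Finset ℝ) (hS : ∀ r ∈ S, r ∈ Set.Icc (0 : ℝ) 1) :
    ∃ σ ∈ stripCone d, C (∏ r ∈ S, (X - C r) ^ n) ∣ f - σ := by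
  classical
  induction S using Finset.induction_on with
  | empty => exact ⟨0, zero_mem _, by simp⟩
  | insert r S hrS ih =>
    obtain ⟨σ, hσ, s, hs⟩ := ih fun t ht => hS t (Finset.mem_insert_of_mem ht)
    obtain ⟨ρ, hρ, t, ht⟩ := exists_local hd ha hD hf (hS r (Finset.mem_insert_self r S)) n
    have hcop : IsCoprime ((X - C r : ℝ[X]) ^ n) (∏ t ∈ S, (X - C t) ^ n) :=
      IsCoprime.prod_right fun t' ht' => (isCoprime_X_sub_C_of_isUnit_sub
        (isUnit_iff_ne_zero.2 (sub_ne_zero.2 (by rintro rfl; exact hrS ht')))).pow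
    rw [Finset.prod_insert hrS]
    set M : ℝ[X] := (X - C r) ^ n
    set N : ℝ[X] := ∏ t ∈ S, (X - C t) ^ n
    obtain ⟨u, v, huv⟩ := id hcop
    have hnn : ∀ (q : ℝ[X]), ∀ x ∈ Set.Icc (0 : ℝ) 1, 0 ≤ (q ^ 2).eval x := fun q x _ => by
      rw [eval_pow]; exact sq_nonneg _
    refine ⟨C ((u * M) ^ 2) * σ + C ((v * N) ^ 2) * ρ,
      add_mem (C_mul_mem_stripCone (hnn _) hσ) (C_mul_mem_stripCone (hnn _) hρ), ?_⟩
    have huv' : C u * C M + C v * C N = (1 : ℝ[X][Y]) := by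
      rw [← C_mul, ← C_mul, ← C_add, huv, C_1]
    rw [C_mul]
    refine (hcop.map C).mul_dvd ⟨t + C u * (1 + C v * C N) * ρ -
        C u ^ 2 * C M * σ, ?_⟩ ⟨s + C v * (1 + C u * C M) * σ - C v ^ 2 * C N * ρ, ?_⟩
    · simp only [C_mul, C_pow]
      linear_combination ht - ρ * (1 + C v * C N) * huv'
    · simp only [C_mul, C_pow]
      linear_combination hs - σ * (1 + C u * C M) * huv'

end Local

section Gluing

/-- A positive polynomial in `Y` dominating all monomials of degree at most `2 * d`. -/
noncomputable def slack (d : ℕ) : ℝ[X] :=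
  ∑ i ∈ Finset.range (2 * d + 1), (X ^ (2 * (i / 2)) + X ^ (2 * ((i + 1) / 2)))

lemma natDegree_slack_le (d : ℕ) : (slack d).natDegree ≤ 2 * d := by
  refine natDegree_sum_le_of_forall_le _ _ fun i hi => ?_
  have := Finset.mem_range.1 hi
  refine (natDegree_add_le _ _).trans (max_le ?_ ?_) <;>
  · rw [natDegree_X_pow]; omega

lemma one_le_slack_eval (d : ℕ) (y : ℝ) : 1 ≤ (slack d).eval y := by
  rw [slack, Finset.sum_range_succ', eval_add, eval_finsetSum]
  have : 0 ≤ ∑ i ∈ Finset.range (2 * d),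
      (X ^ (2 * ((i + 1) / 2)) + X ^ (2 * ((i + 1 + 1) / 2)) : ℝ[X]).eval y := by
    refine Finset.sum_nonneg fun i _ => ?_
    simp only [eval_add, eval_pow, eval_X, pow_mul]
    positivity
  simp only [eval_add, eval_pow, eval_X] at this ⊢
  norm_num
  linarith

lemma add_slack_mem_stripCone {h : ℝ[X][Y]} {d : ℕ} (hd : h.natDegree ≤ 2 * d) {ε : ℝ[X]}
    (hε : ∀ x ∈ Set.Icc (0 : ℝ) 1, ∀ i, |(h.coeff i).eval x| ≤ ε.eval x) :
    h + C ε * (slack d).map C ∈ stripCone d := by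
  have key : h + C ε * (slack d).map C = ∑ i ∈ Finset.range (2 * d + 1),
      (C (C (1 / 2) * ε + C (1 / 4) * h.coeff i) * (X ^ (i / 2) + X ^ ((i + 1) / 2)) ^ 2 +
        C (C (1 / 2) * ε - C (1 / 4) * h.coeff i) * (X ^ (i / 2) - X ^ ((i + 1) / 2)) ^ 2) := by
    conv_lhs => rw [h.as_sum_range_C_mul_X_pow' (show h.natDegree < 2 * d + 1 by omega), slack,
      Polynomial.map_sum, Finset.mul_sum, ← Finset.sum_add_distrib]
    refine Finset.sum_congr rfl fun i _ => ?_
    have hi : (X : ℝ[X][Y]) ^ i = X ^ (i / 2) * X ^ ((i + 1) / 2) := by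
      rw [← pow_add]; congr 1; omega
    have h2 : (C (C (1 / 2)) : ℝ[X][Y]) * 2 = 1 := by
      have : (2 : ℝ[X][Y]) = C (C 2) := rfl
      rw [this, ← C_mul, ← C_mul]; norm_num
    have h4 : (C (C (1 / 4)) : ℝ[X][Y]) * 4 = 1 := by
      have : (4 : ℝ[X][Y]) = C (C 4) := rfl
      rw [this, ← C_mul, ← C_mul]; norm_num
    rw [hi]
    simp only [Polynomial.map_add, Polynomial.map_pow, map_X, C_add, C_sub, C_mul]
    rw [mul_comm 2 (i / 2), mul_comm 2 ((i + 1) / 2), pow_mul, pow_mul]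
    generalize (X : ℝ[X][Y]) ^ (i / 2) = u
    generalize (X : ℝ[X][Y]) ^ ((i + 1) / 2) = v
    linear_combination (- C ε * (u ^ 2 + v ^ 2)) * h2 - (C (h.coeff i) * u * v) * h4
  rw [key]
  refine sum_mem fun i hi => ?_
  have hi' := Finset.mem_range.1 hi
  have h1 : (X ^ (i / 2) : ℝ[X][Y]).natDegree ≤ d := by rw [natDegree_X_pow]; omega
  have h2 : (X ^ ((i + 1) / 2) : ℝ[X][Y]).natDegree ≤ d := by rw [natDegree_X_pow]; omega
  refine add_mem (C_mul_sq_mem_stripCone (fun x hx => ?_)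
    ((natDegree_add_le _ _).trans (max_le h1 h2))) (C_mul_sq_mem_stripCone (fun x hx => ?_)
    ((natDegree_sub_le _ _).trans (max_le h1 h2)))
  · have := abs_le.1 (hε x hx i)
    have := abs_nonneg ((h.coeff i).eval x)
    simp only [eval_add, eval_mul, eval_C]
    linarith [hε x hx i]
  · have := abs_le.1 (hε x hx i)
    have := abs_nonneg ((h.coeff i).eval x)
    simp only [eval_sub, eval_mul, eval_C]
    linarith [hε x hx i]

lemma map_C_mem_stripCone {d : ℕ} {p : ℝ[X]} (hp : p ∈ boundedSumSq d) :
    p.map C ∈ stripCone d := by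
  induction hp using AddSubmonoid.closure_induction with
  | mem p h =>
    obtain ⟨g, hg, rfl⟩ := h
    have := C_mul_sq_mem_stripCone (p := 1) (g := g.map C) (d := d) (fun x _ => by simp)
      (natDegree_map_le.trans hg)
    simpa using this
  | zero => simp
  | add p q _ _ hp hq => rw [Polynomial.map_add]; exact add_mem hp hq

lemma eval_map_evalRingHom (f : ℝ[X][Y]) (x y : ℝ) :
    (f.map (evalRingHom x)).eval y = f.evalEval x y := by
  rw [← eval₂_evalRingHom, eval_map]

lemma exists_abs_eval_le (p : ℝ[X]) : ∃ M, ∀ x ∈ Set.Icc (0 : ℝ) 1, |p.eval x| ≤ M :=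
  isCompact_Icc.exists_bound_of_continuousOn p.continuous.continuousOn

lemma exists_abs_coeff_eval_le (f : ℝ[X][Y]) :
    ∃ M, 0 ≤ M ∧ ∀ x ∈ Set.Icc (0 : ℝ) 1, ∀ i, |(f.coeff i).eval x| ≤ M := by
  choose m hm using fun i => exists_abs_eval_le (f.coeff i)
  have hm0 : ∀ i, 0 ≤ m i := fun i => (abs_nonneg _).trans (hm i 0 (by simp))
  refine ⟨∑ i ∈ Finset.range (f.natDegree + 1), m i, Finset.sum_nonneg fun i _ => hm0 i,
    fun x hx i => ?_⟩
  by_cases hi : i ≤ f.natDegree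
  · exact (hm i x hx).trans
      (Finset.single_le_sum (fun i _ => hm0 i) (Finset.mem_range.2 (by omega)))
  · rw [coeff_eq_zero_of_natDegree_lt (by omega), eval_zero, abs_zero]
    exact Finset.sum_nonneg fun i _ => hm0 i

/-- A nonnegative polynomial times a nonnegative continuous function of `X` is approximated by
elements of the cone, via Bernstein polynomials. -/
lemma exists_mem_stripCone_approx {g : ℝ[X][Y]} {d : ℕ} (hd : g.natDegree ≤ 2 * d)
    (hg : ∀ x ∈ Set.Icc (0 : ℝ) 1, ∀ y, 0 ≤ g.evalEval x y) {ψ : ℝ → ℝ} (hψ : Continuous ψ)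
    (hψ0 : ∀ x, 0 ≤ ψ x) {η : ℝ} (hη : 0 < η) :
    ∃ B ∈ stripCone d, ∀ x ∈ Set.Icc (0 : ℝ) 1, ∀ i,
      |(B.coeff i).eval x - ψ x * (g.coeff i).eval x| ≤ η := by
  let φ : ℕ → C(unitInterval, ℝ) := fun i =>
    ⟨fun x => ψ x * (g.coeff i).eval (x : ℝ), by fun_prop⟩
  have hev : ∀ᶠ n in Filter.atTop, ∀ i ∈ Finset.range (2 * d + 1),
      dist (bernsteinApproximation n (φ i)) (φ i) < η := by
    rw [Filter.eventually_all_finset]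
    intro i _
    exact (bernsteinApproximation_uniform (φ i)).eventually (Metric.ball_mem_nhds _ hη)
  obtain ⟨n, hn⟩ := hev.exists
  let P : Fin (n + 1) → ℝ[X] := fun k =>
    C (ψ (bernstein.z k)) * g.map (evalRingHom (bernstein.z k : ℝ))
  let B : ℝ[X][Y] := ∑ k : Fin (n + 1), C (bernsteinPolynomial ℝ n k) * (P k).map C
  have hPd : ∀ k, (P k).natDegree ≤ 2 * d := fun k =>
    (natDegree_C_mul_le _ _).trans (natDegree_map_le.trans hd)
  have hB : B ∈ stripCone d := by
    refine sum_mem fun k _ => C_mul_mem_stripCone (fun x hx => ?_) (map_C_mem_stripCone ?_)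
    · exact bernstein_nonneg (n := n) (ν := k) (x := ⟨x, hx⟩)
    · refine boundedSumSq_mono ?_ (mem_boundedSumSq_of_nonneg (P k) fun y => ?_)
      · have := hPd k
        omega
      · rw [eval_mul, eval_C, eval_map_evalRingHom]
        exact mul_nonneg (hψ0 _) (hg _ (bernstein.z k).2 y)
  refine ⟨B, hB, fun x hx i => ?_⟩
  by_cases hi : i ∈ Finset.range (2 * d + 1)
  · have h1 := (ContinuousMap.dist_lt_iff hη).1 (hn i hi) ⟨x, hx⟩
    rw [Real.dist_eq, bernsteinApproximation.apply] at h1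
    have h2 : (B.coeff i).eval x =
        ∑ k : Fin (n + 1), bernstein n k ⟨x, hx⟩ • φ i (bernstein.z k) := by
      simp only [B, P, φ, finsetSum_coeff, eval_finsetSum, coeff_C_mul, coeff_map, eval_mul, eval_C,
        coe_evalRingHom, ContinuousMap.coe_mk, smul_eq_mul]
      rfl
    rw [h2]
    exact h1.le
  · rw [Finset.mem_range] at hi
    have := natDegree_le_of_mem_stripCone hB
    rw [coeff_eq_zero_of_natDegree_lt (by omega), coeff_eq_zero_of_natDegree_lt (by omega)]
    simpa using hη.le

lemma evalEval_slack (d : ℕ) (x y : ℝ) :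
    ((slack d).map C : ℝ[X][Y]).evalEval x y = (slack d).eval y := by
  rw [evalEval_map_C]

lemma gluing_estimate {a b e h s t q c η τ H M ε : ℝ} (hε : ε = c * e ^ 2) (hc : 0 < c)
    (hη : 0 < η) (hτ : 0 < τ) (hH : |h| ≤ H) (hM : |s| ≤ M) (ht : t = 1 / max (c * τ ^ 2) ε)
    (hq : |q - t| ≤ η) (hb : |b - t * a| ≤ η) (hs : a - s = e ^ 3 * h)
    (hη' : η * (1 + 2 * M) ≤ 1 / 2) (hτ' : τ * H ≤ c / 2) :
    0 ≤ 1 - ε * q + ε * η ∧ |a - ε * b - (1 - ε * q + ε * η) * s| ≤ ε := by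
  have hε0 : 0 ≤ ε := by rw [hε]; positivity
  have hmax : 0 < max (c * τ ^ 2) ε := lt_max_of_lt_left (by positivity)
  have htε : ε * t ≤ 1 := by
    rw [ht, mul_one_div, div_le_one hmax]; exact le_max_right _ _
  have ht0 : 0 ≤ ε * t := by rw [ht]; positivity
  have hq' := abs_le.1 hq
  refine ⟨by nlinarith [mul_le_mul_of_nonneg_left hq'.2 hε0], ?_⟩
  have h1 : |(1 - ε * t) * (e ^ 3 * h)| ≤ ε * (1 / 2) := by
    by_cases he : |e| < τ
    · rw [abs_mul, abs_of_nonneg (by linarith), abs_mul, abs_pow]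
      calc (1 - ε * t) * (|e| ^ 3 * |h|) ≤ 1 * (|e| ^ 3 * |h|) := by
            gcongr; linarith
        _ = e ^ 2 * (|e| * |h|) := by rw [← sq_abs]; ring
        _ ≤ e ^ 2 * (τ * H) := by gcongr
        _ ≤ e ^ 2 * (c / 2) := by gcongr
        _ = ε * (1 / 2) := by rw [hε]; ring
    · have h2 : c * τ ^ 2 ≤ ε := by
        rw [hε, ← sq_abs e]
        gcongr
        exact not_lt.1 he
      have h3 : ε * t = 1 := by
        rw [max_eq_right h2] at ht hmax
        rw [ht, mul_one_div_cancel hmax.ne']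
      rw [h3, sub_self, zero_mul, abs_zero]
      positivity
  have h2 : |ε * (t * a - b)| ≤ ε * η := by
    rw [abs_mul, abs_of_nonneg hε0, abs_sub_comm]; gcongr
  have h3 : |ε * ((q - t) * s)| ≤ ε * (η * M) := by
    rw [abs_mul, abs_of_nonneg hε0, abs_mul]; gcongr
  have h4 : |ε * (η * s)| ≤ ε * (η * M) := by
    rw [abs_mul, abs_of_nonneg hε0, abs_mul, abs_of_pos hη]; gcongr
  have h5 : a - ε * b - (1 - ε * q + ε * η) * s = (1 - ε * t) * (e ^ 3 * h) + ε * (t * a - b) +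
      ε * ((q - t) * s) - ε * (η * s) := by
    rw [← hs]; ring
  have h6 := mul_le_mul_of_nonneg_left hη' hε0
  rw [h5]
  rw [abs_le] at *
  constructor <;> linarith

/-- A nonnegative polynomial that agrees with an element of the cone modulo `E ^ 3` belongs to the
cone after adding a multiple of `E ^ 2`. -/
lemma gluing {g σ h : ℝ[X][Y]} {d : ℕ} (hd : g.natDegree ≤ 2 * d)
    (hg : ∀ x ∈ Set.Icc (0 : ℝ) 1, ∀ y, 0 ≤ g.evalEval x y) (hσ : σ ∈ stripCone d) {E : ℝ[X]}
    (hE : g - σ = C (E ^ 3) * h) {c : ℝ} (hc : 0 < c) :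
    g + C (C c * E ^ 2) * (slack d).map C ∈ stripCone d := by
  obtain ⟨M, hM0, hM⟩ := exists_abs_coeff_eval_le σ
  obtain ⟨H, hH0, hH⟩ := exists_abs_coeff_eval_le h
  set ε : ℝ[X] := C c * E ^ 2 with hε
  set τ := c / (2 * (H + 1)) with hτ
  have hτ0 : 0 < τ := by positivity
  have hτ' : τ * H ≤ c / 2 := by
    rw [hτ, div_mul_eq_mul_div, div_le_div_iff₀ (by positivity) two_pos]
    nlinarith
  set η := 1 / (2 * (1 + 2 * M)) with hη
  have hη0 : 0 < η := by positivity
  have hη' : η * (1 + 2 * M) ≤ 1 / 2 := by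
    rw [hη]; apply le_of_eq; field_simp
  have hmax : ∀ x : ℝ, 0 < max (c * τ ^ 2) (ε.eval x) := fun x => lt_max_of_lt_left (by positivity)
  have hψ : Continuous fun x : ℝ => 1 / max (c * τ ^ 2) (ε.eval x) :=
    continuous_const.div (continuous_const.max ε.continuous) fun x => (hmax x).ne'
  obtain ⟨B, hB, hBa⟩ := exists_mem_stripCone_approx hd hg hψ
    (fun x => (one_div_pos.2 (hmax x)).le) hη0
  obtain ⟨q, hq⟩ := exists_polynomial_near_of_continuousOn 0 1 _ hψ.continuousOn η hη0
  have hest := fun (x : ℝ) (hx : x ∈ Set.Icc (0 : ℝ) 1) (i : ℕ) =>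
    gluing_estimate (a := (g.coeff i).eval x) (b := (B.coeff i).eval x) (e := E.eval x)
      (h := (h.coeff i).eval x) (s := (σ.coeff i).eval x) (ε := ε.eval x) (q := q.eval x)
      (by rw [hε]; simp) hc hη0 hτ0 (hH x hx i) (hM x hx i) rfl (hq x hx).le (hBa x hx i)
      (by rw [← eval_sub, ← coeff_sub, hE, coeff_C_mul, eval_mul, eval_pow]) hη' hτ'
  set r : ℝ[X] := 1 - ε * q + ε * C η with hr
  have hεnn : ∀ x ∈ Set.Icc (0 : ℝ) 1, 0 ≤ ε.eval x := fun x _ => by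
    rw [hε]; simp only [eval_mul, eval_C, eval_pow]; positivity
  have h1 : C ε * B ∈ stripCone d := C_mul_mem_stripCone hεnn hB
  have h2 : C r * σ ∈ stripCone d := C_mul_mem_stripCone (fun x hx => by
    rw [hr]; simpa using (hest x hx 0).1) hσ
  have h3 : (g - C ε * B - C r * σ) + C ε * (slack d).map C ∈ stripCone d := by
    refine add_slack_mem_stripCone ?_ fun x hx i => ?_
    · exact (natDegree_sub_le_of_le (natDegree_sub_le_of_le hd
        (natDegree_le_of_mem_stripCone h1)) (natDegree_le_of_mem_stripCone h2)).trans (by simp)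
    · have := (hest x hx i).2
      rw [coeff_sub, coeff_sub, coeff_C_mul, coeff_C_mul]
      simpa [hr] using this
  have h4 : g + C ε * (slack d).map C =
      C ε * B + C r * σ + ((g - C ε * B - C r * σ) + C ε * (slack d).map C) := by ring
  rw [h4]
  exact add_mem (add_mem h1 h2) h3

/-- Up to a positive constant, a nonzero polynomial is bounded below on `[0,1]` by a power of a
product of linear factors with roots in `[0,1]`. -/
lemma exists_prod_sq_le_sq {D : ℝ[X]} (hD : D ≠ 0) : ∃ (S : Finset ℝ) (k : ℕ) (c : ℝ),
    (∀ r ∈ S, r ∈ Set.Icc (0 : ℝ) 1) ∧ 0 < c ∧ ∀ x ∈ Set.Icc (0 : ℝ) 1,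
      c * ((∏ r ∈ S, (X - C r) ^ k : ℝ[X]).eval x) ^ 2 ≤ (D.eval x) ^ 2 := by
  classical
  induction hn : D.natDegree using Nat.strong_induction_on generalizing D with
  | _ n ih =>
  subst hn
  by_cases h : ∃ r ∈ Set.Icc (0 : ℝ) 1, D.IsRoot r
  · obtain ⟨r, hr, hr0⟩ := h
    obtain ⟨D, rfl⟩ := dvd_iff_isRoot.2 hr0
    have hD1 : D ≠ 0 := right_ne_zero_of_mul hD
    obtain ⟨S, k, c, hS, hc, hle⟩ := ih D.natDegree
      (by rw [natDegree_mul (X_sub_C_ne_zero r) hD1, natDegree_X_sub_C]; omega) hD1 rfl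
    refine ⟨insert r S, k + 1, c, (Finset.forall_mem_insert _ _ _).2 ⟨hr, hS⟩, hc, fun x hx => ?_⟩
    have habs : ∀ t ∈ Set.Icc (0 : ℝ) 1, |x - t| ≤ 1 := fun t ht =>
      abs_le.2 ⟨by linarith [hx.1, ht.2], by linarith [hx.2, ht.1]⟩
    have hprod : ∀ T : Finset ℝ, (∀ t ∈ T, t ∈ Set.Icc (0 : ℝ) 1) → ∏ t ∈ T, |x - t| ≤ 1 :=
      fun T hT => Finset.prod_le_one (fun _ _ => abs_nonneg _) fun t ht => habs t (hT t ht)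
    have hprod0 : ∀ T : Finset ℝ, 0 ≤ ∏ t ∈ T, |x - t| := fun T =>
      Finset.prod_nonneg fun _ _ => abs_nonneg _
    have hle' : (∏ t ∈ insert r S, |x - t|) ^ (k + 1) ≤ |x - r| * (∏ t ∈ S, |x - t|) ^ k := by
      by_cases hrS : r ∈ S
      · rw [Finset.insert_eq_of_mem hrS, pow_succ, mul_comm]
        gcongr
        rw [← Finset.mul_prod_erase S _ hrS]
        exact mul_le_of_le_one_right (abs_nonneg _)
          (hprod _ fun t ht => hS t (Finset.mem_of_mem_erase ht))
      · rw [Finset.prod_insert hrS, mul_pow]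
        exact mul_le_mul (pow_le_of_le_one (abs_nonneg _) (habs r hr) (by omega))
          (pow_le_pow_of_le_one (hprod0 S) (hprod S hS) (by omega)) (pow_nonneg (hprod0 S) _)
          (abs_nonneg _)
    have hev : ∀ (T : Finset ℝ) (k : ℕ), ((∏ t ∈ T, (X - C t) ^ k : ℝ[X]).eval x) ^ 2 =
        ((∏ t ∈ T, |x - t|) ^ k) ^ 2 := by
      intro T k
      rw [← sq_abs, Finset.prod_pow, eval_pow, eval_prod, abs_pow, Finset.abs_prod]
      simp
    have h1 := hle x hx
    rw [hev] at h1 ⊢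
    rw [eval_mul, mul_pow]
    calc c * ((∏ t ∈ insert r S, |x - t|) ^ (k + 1)) ^ 2
        ≤ c * (|x - r| * (∏ t ∈ S, |x - t|) ^ k) ^ 2 := by
          gcongr
      _ = (x - r) ^ 2 * (c * ((∏ t ∈ S, |x - t|) ^ k) ^ 2) := by rw [← sq_abs (x - r)]; ring
      _ ≤ (x - r) ^ 2 * (D.eval x) ^ 2 := by gcongr
      _ = _ := by simp
  · push Not at h
    obtain ⟨x₀, hx₀, hmin⟩ := isCompact_Icc.exists_isMinOn (Set.nonempty_Icc.2 zero_le_one)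
      ((D.continuous.pow 2).continuousOn (s := Set.Icc (0 : ℝ) 1))
    refine ⟨∅, 0, (D.eval x₀) ^ 2, by simp, sq_pos_of_ne_zero (h x₀ hx₀), fun x hx => ?_⟩
    simpa using hmin hx

/-- Nonnegative polynomials with a positive leading coefficient that are bounded below by a
multiple of `slack` belong to the cone. -/
lemma mem_stripCone_of_slack_le {f : ℝ[X][Y]} {d : ℕ} (hd : f.natDegree ≤ 2 * d)
    (ha : ∀ x ∈ Set.Icc (0 : ℝ) 1, 0 < (f.coeff (2 * d)).eval x) {D : ℝ[X]} (hD : D ≠ 0)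
    (hf : ∀ x ∈ Set.Icc (0 : ℝ) 1, ∀ y, (D.eval x) ^ 2 * (slack d).eval y ≤ f.evalEval x y) :
    f ∈ stripCone d := by
  obtain ⟨S, k, c₁, hS, hc₁, hle⟩ := exists_prod_sq_le_sq hD
  set E : ℝ[X] := ∏ r ∈ S, (X - C r) ^ k with hE
  have hE0 : E ≠ 0 := Finset.prod_ne_zero_iff.2 fun r _ => pow_ne_zero _ (X_sub_C_ne_zero r)
  obtain ⟨x₀, hx₀, hmin⟩ := isCompact_Icc.exists_isMinOn (Set.nonempty_Icc.2 zero_le_one)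
    ((f.coeff (2 * d)).continuous.continuousOn (s := Set.Icc (0 : ℝ) 1))
  have ha₀ := ha x₀ hx₀
  set a₀ := (f.coeff (2 * d)).eval x₀
  obtain ⟨M, hM⟩ := exists_abs_eval_le (E ^ 2 * C ((slack d).coeff (2 * d)))
  have hM0 : 0 ≤ M := (abs_nonneg _).trans (hM 0 (by simp))
  set c := min (c₁ / 2) (a₀ / (2 * (M + 1))) with hc
  have hc0 : 0 < c := by positivity
  have hcM : c * M ≤ a₀ / 2 := by
    calc c * M ≤ a₀ / (2 * (M + 1)) * M := by gcongr; exact min_le_right _ _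
      _ ≤ a₀ / 2 := by
        rw [div_mul_eq_mul_div, div_le_div_iff₀ (by positivity) two_pos]
        nlinarith
  set g := f - C (C c * E ^ 2) * (slack d).map C with hg
  have hgd : g.natDegree ≤ 2 * d := (natDegree_sub_le_of_le hd
    ((natDegree_C_mul_le _ _).trans (natDegree_map_le.trans (natDegree_slack_le d)))).trans
    (by simp)
  have hga : ∀ x ∈ Set.Icc (0 : ℝ) 1, 0 < (g.coeff (2 * d)).eval x := by
    intro x hx
    have h1 := abs_le.1 (hM x hx)
    have h2 : a₀ ≤ (f.coeff (2 * d)).eval x := hmin hx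
    rw [hg, coeff_sub, coeff_C_mul, coeff_map]
    simp only [eval_sub, eval_mul, eval_C, eval_pow] at h1 ⊢
    nlinarith
  have hgl : ∀ x ∈ Set.Icc (0 : ℝ) 1, ∀ y, ((C √c * E).eval x) ^ 2 ≤ g.evalEval x y := by
    intro x hx y
    have h1 := hle x hx
    have h2 := hf x hx y
    have h3 := one_le_slack_eval d y
    have h4 : 2 * c ≤ c₁ := by have := min_le_left (c₁ / 2) (a₀ / (2 * (M + 1))); linarith
    rw [hg, evalEval_sub, evalEval_mul, evalEval_slack, evalEval_C]
    simp only [eval_mul, eval_C, eval_pow]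
    rw [mul_pow, Real.sq_sqrt hc0.le]
    have h5 : 2 * c * (E.eval x) ^ 2 ≤ (D.eval x) ^ 2 :=
      (mul_le_mul_of_nonneg_right h4 (sq_nonneg _)).trans h1
    have h6 := mul_le_mul_of_nonneg_right h5 (zero_le_one.trans h3)
    have h7 := mul_le_mul_of_nonneg_left h3 (by positivity : 0 ≤ c * (E.eval x) ^ 2)
    linarith
  obtain ⟨σ, hσ, h, hh⟩ := exists_semilocal hgd hga
    (mul_ne_zero (C_ne_zero.2 (Real.sqrt_pos.2 hc0).ne') hE0) hgl (k * 3) S hS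
  have hE3 : ∏ r ∈ S, (X - C r) ^ (k * 3) = E ^ 3 := by
    rw [hE, ← Finset.prod_pow]
    exact Finset.prod_congr rfl fun r _ => pow_mul _ _ _
  rw [hE3] at hh
  have := gluing hgd (fun x hx y => (sq_nonneg _).trans (hgl x hx y)) hσ hh hc0
  rwa [hg, sub_add_cancel] at this

end Gluing

section LowerBound

lemma continuous_evalEval (f : ℝ[X][Y]) : Continuous fun z : ℝ × ℝ => f.evalEval z.1 z.2 := by
  induction f using Polynomial.induction_on' with
  | add p q hp hq => simp only [evalEval_add]; exact hp.add hq
  | monomial n a =>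
    simp only [← C_mul_X_pow_eq_monomial, evalEval_mul, evalEval_pow, evalEval_C, evalEval_X]
    fun_prop

lemma exists_abs_evalEval_le (f : ℝ[X][Y]) (R : ℝ) : ∃ M, ∀ x ∈ Set.Icc (0 : ℝ) 1,
    ∀ y ∈ Set.Icc (-R) R, |f.evalEval x y| ≤ M := by
  obtain ⟨M, hM⟩ := (isCompact_Icc.prod isCompact_Icc).exists_bound_of_continuousOn
    (continuous_evalEval f).continuousOn (s := Set.Icc (0 : ℝ) 1 ×ˢ Set.Icc (-R) R)
  exact ⟨M, fun x hx y hy => hM (x, y) ⟨hx, hy⟩⟩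

lemma exists_taylor_bound (f : ℝ[X][Y]) (R : ℝ) : ∃ M, 0 ≤ M ∧ ∀ x ∈ Set.Icc (0 : ℝ) 1,
    ∀ y ∈ Set.Icc (-R) R, ∀ h, |h| ≤ 1 →
      f.evalEval x (y + h) ≤ f.evalEval x y + f.derivative.evalEval x y * h + M * h ^ 2 := by
  choose m hm using fun k => exists_abs_evalEval_le (hasseDeriv k f) R
  refine ⟨∑ k ∈ Finset.range f.natDegree, |m (k + 2)|,
    Finset.sum_nonneg fun _ _ => abs_nonneg _, fun x hx y hy h hh => ?_⟩
  set p := f.map (evalRingHom x) with hp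
  have hcoeff : ∀ k, (taylor y p).coeff k = (hasseDeriv k f).evalEval x y := by
    intro k
    rw [taylor_coeff, ← eval_map_evalRingHom]
    congr 1
    ext i
    simp [hp, hasseDeriv_coeff]
  have hdeg : (taylor y p).natDegree < f.natDegree + 1 + 1 := by
    rw [natDegree_taylor]
    have : p.natDegree ≤ f.natDegree := natDegree_map_le
    omega
  have h1 : f.evalEval x (y + h) = (taylor y p).eval h := by
    rw [taylor_eval, hp, eval_map_evalRingHom, add_comm]
  rw [h1, eval_eq_sum_range' hdeg, Finset.sum_range_succ', Finset.sum_range_succ', hcoeff, hcoeff,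
    hasseDeriv_zero', hasseDeriv_one', Finset.sum_mul]
  have h2 : ∑ k ∈ Finset.range f.natDegree, (taylor y p).coeff (k + 1 + 1) * h ^ (k + 1 + 1) ≤
      ∑ k ∈ Finset.range f.natDegree, |m (k + 2)| * h ^ 2 := by
    refine Finset.sum_le_sum fun k _ => ?_
    rw [hcoeff]
    calc _ ≤ |(hasseDeriv (k + 1 + 1) f).evalEval x y * h ^ (k + 1 + 1)| := le_abs_self _
      _ = |(hasseDeriv (k + 2) f).evalEval x y| * (|h| ^ k * h ^ 2) := by
        rw [abs_mul, abs_pow, ← sq_abs h]; ring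
      _ ≤ |m (k + 2)| * (1 * h ^ 2) :=
        mul_le_mul ((hm (k + 2) x hx y hy).trans (le_abs_self _))
          (mul_le_mul_of_nonneg_right (pow_le_one₀ (abs_nonneg h) hh) (sq_nonneg h))
          (by positivity) (abs_nonneg _)
      _ = _ := by rw [one_mul]
  simp only [zero_add, pow_one, pow_zero, mul_one]
  linarith

/-- On a compact part of the strip, the square of the derivative of a nonnegative polynomial is
bounded by a multiple of the polynomial. -/
lemma exists_derivative_sq_le {f : ℝ[X][Y]}
    (hf : ∀ x ∈ Set.Icc (0 : ℝ) 1, ∀ y, 0 ≤ f.evalEval x y) (R : ℝ) :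
    ∃ M, 0 ≤ M ∧ ∀ x ∈ Set.Icc (0 : ℝ) 1, ∀ y ∈ Set.Icc (-R) R,
      (f.derivative.evalEval x y) ^ 2 ≤ M * f.evalEval x y := by
  obtain ⟨M₁, hM₁0, hM₁⟩ := exists_taylor_bound f R
  obtain ⟨M₂, hM₂⟩ := exists_abs_evalEval_le f.derivative R
  set M := max (M₁ + 1) M₂ with hM
  have hM1 : M₁ + 1 ≤ M := le_max_left _ _
  refine ⟨4 * M, by linarith, fun x hx y hy => ?_⟩
  set a := f.evalEval x y
  set b := f.derivative.evalEval x y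
  have hb : |b| ≤ M := (hM₂ x hx y hy).trans (le_max_right _ _)
  have h1 := hM₁ x hx y hy (-b / (2 * M)) (by
    rw [abs_div, abs_neg, abs_of_pos (by linarith : 0 < 2 * M), div_le_one (by linarith)]
    linarith)
  have h2 := (hf x hx (y + -b / (2 * M))).trans h1
  have h3 : M₁ * (-b / (2 * M)) ^ 2 ≤ M * (-b / (2 * M)) ^ 2 := by gcongr; linarith
  have h4 : a + b * (-b / (2 * M)) + M * (-b / (2 * M)) ^ 2 = a - b ^ 2 / (4 * M) := by
    field_simp; ring
  have h5 : b ^ 2 / (4 * M) ≤ a := by linarith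
  rwa [div_le_iff₀ (by linarith), mul_comm] at h5

lemma exists_tail_bound {f : ℝ[X][Y]} {d : ℕ} (hd : f.natDegree ≤ 2 * d)
    (ha : ∀ x ∈ Set.Icc (0 : ℝ) 1, 0 < (f.coeff (2 * d)).eval x) :
    ∃ R c, 0 < c ∧ ∀ x ∈ Set.Icc (0 : ℝ) 1, ∀ y, R ≤ |y| →
      c * (slack d).eval y ≤ f.evalEval x y := by
  obtain ⟨x₀, hx₀, hmin⟩ := isCompact_Icc.exists_isMinOn (Set.nonempty_Icc.2 zero_le_one)
    ((f.coeff (2 * d)).continuous.continuousOn (s := Set.Icc (0 : ℝ) 1))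
  have ha₀ := ha x₀ hx₀
  set a₀ := (f.coeff (2 * d)).eval x₀
  obtain ⟨M, hM0, hM⟩ := exists_abs_coeff_eval_le f
  set K : ℝ := ∑ _i ∈ Finset.range (2 * d + 1), 2 with hK
  have hK0 : 0 < K := Finset.sum_pos (fun _ _ => two_pos) ⟨0, by simp⟩
  set L : ℝ := ∑ _i ∈ Finset.range (2 * d), M with hL
  refine ⟨max 1 (2 * L / a₀), a₀ / (2 * K), by positivity, fun x hx y hy => ?_⟩
  have hy1 : 1 ≤ |y| := (le_max_left _ _).trans hy
  have hy0 : 0 < |y| := by linarith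
  have hyL : 2 * L ≤ a₀ * |y| := by
    rw [mul_comm a₀, ← div_le_iff₀ ha₀]; exact (le_max_right _ _).trans hy
  have hslack : (slack d).eval y ≤ K * |y| ^ (2 * d) := by
    rw [slack, eval_finsetSum, hK, Finset.sum_mul]
    refine Finset.sum_le_sum fun i hi => ?_
    have hi := Finset.mem_range.1 hi
    simp only [eval_add, eval_pow, eval_X]
    have h1 : ∀ j, 2 * j ≤ 2 * d → y ^ (2 * j) ≤ |y| ^ (2 * d) := fun j hj => by
      rw [← (even_two_mul j).pow_abs]
      exact pow_le_pow_right₀ hy1 hj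
    linarith [h1 (i / 2) (by omega), h1 ((i + 1) / 2) (by omega)]
  have hsum : f.evalEval x y = ∑ i ∈ Finset.range (2 * d + 1), (f.coeff i).eval x * y ^ i := by
    rw [← eval_map_evalRingHom, eval_eq_sum_range' (n := 2 * d + 1)
      (by have : (f.map (evalRingHom x)).natDegree ≤ f.natDegree := natDegree_map_le
          omega)]
    simp
  have hlow : |∑ i ∈ Finset.range (2 * d), (f.coeff i).eval x * y ^ i| * |y| ≤
      L * |y| ^ (2 * d) := by
    rw [hL, Finset.sum_mul, ← abs_mul, Finset.sum_mul]
    refine (Finset.abs_sum_le_sum_abs _ _).trans (Finset.sum_le_sum fun i hi => ?_)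
    have hi := Finset.mem_range.1 hi
    rw [abs_mul, abs_mul, abs_pow, mul_assoc, ← pow_succ]
    gcongr
    · exact hM x hx i
    · omega
  have hlead : a₀ ≤ (f.coeff (2 * d)).eval x := hmin hx
  have hpow : 0 < |y| ^ (2 * d) := by positivity
  have h1 : a₀ / 2 * |y| ^ (2 * d) ≤ f.evalEval x y := by
    rw [hsum, Finset.sum_range_succ]
    set s := ∑ i ∈ Finset.range (2 * d), (f.coeff i).eval x * y ^ i
    rw [← (even_two_mul d).pow_abs y]
    have h2 : |s| ≤ a₀ / 2 * |y| ^ (2 * d) := by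
      refine le_of_mul_le_mul_right (hlow.trans ?_) hy0
      nlinarith
    have h3 := mul_le_mul_of_nonneg_right hlead hpow.le
    have := neg_abs_le s
    linarith
  refine le_trans ?_ h1
  calc a₀ / (2 * K) * (slack d).eval y ≤ a₀ / (2 * K) * (K * |y| ^ (2 * d)) := by gcongr
    _ = _ := by field_simp

/-- A nonnegative polynomial with positive leading coefficient and nonzero discriminant is bounded
below by a multiple of `slack`. -/
lemma exists_slack_le {f u v : ℝ[X][Y]} {d : ℕ} (hd : f.natDegree ≤ 2 * d)
    (ha : ∀ x ∈ Set.Icc (0 : ℝ) 1, 0 < (f.coeff (2 * d)).eval x)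
    (hf : ∀ x ∈ Set.Icc (0 : ℝ) 1, ∀ y, 0 ≤ f.evalEval x y) {D : ℝ[X]} (hD : D ≠ 0)
    (huv : u * f + v * f.derivative = C D) :
    ∃ E : ℝ[X], E ≠ 0 ∧ ∀ x ∈ Set.Icc (0 : ℝ) 1, ∀ y,
      (E.eval x) ^ 2 * (slack d).eval y ≤ f.evalEval x y := by
  obtain ⟨R, c₁, hc₁, htail⟩ := exists_tail_bound hd ha
  obtain ⟨M, hM0, hM⟩ := exists_derivative_sq_le hf R
  obtain ⟨F, hF⟩ := exists_abs_evalEval_le f R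
  obtain ⟨U, hU⟩ := exists_abs_evalEval_le u R
  obtain ⟨V, hV⟩ := exists_abs_evalEval_le v R
  obtain ⟨S, hS⟩ := exists_abs_evalEval_le ((slack d).map C) R
  obtain ⟨B, hB⟩ := exists_abs_eval_le D
  set K := 2 * U ^ 2 * |F| + 2 * V ^ 2 * M with hK
  set c := min (1 / (K * |S| + 1)) (c₁ / (B ^ 2 + 1)) with hc
  have hc0 : 0 < c := by positivity
  refine ⟨C √c * D, mul_ne_zero (C_ne_zero.2 (Real.sqrt_pos.2 hc0).ne') hD, fun x hx y => ?_⟩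
  have hs1 := one_le_slack_eval d y
  rw [eval_mul, eval_C, mul_pow, Real.sq_sqrt hc0.le]
  by_cases hy : R ≤ |y|
  · refine le_trans ?_ (htail x hx y hy)
    gcongr
    have h1 : (D.eval x) ^ 2 ≤ B ^ 2 := by rw [← sq_abs]; gcongr; exact hB x hx
    calc c * (D.eval x) ^ 2 ≤ c₁ / (B ^ 2 + 1) * (B ^ 2 + 1) := by
          gcongr
          · exact min_le_right _ _
          · linarith
      _ = c₁ := by field_simp
  · have hy' : y ∈ Set.Icc (-R) R := by
      have := abs_lt.1 (not_le.1 hy)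
      exact ⟨this.1.le, this.2.le⟩
    have h0 := hf x hx y
    have h1 : D.eval x = u.evalEval x y * f.evalEval x y + v.evalEval x y *
        f.derivative.evalEval x y := by
      rw [← evalEval_mul, ← evalEval_mul, ← evalEval_add, huv, evalEval_C]
    have h2 : (D.eval x) ^ 2 ≤ K * f.evalEval x y := by
      have hu2 : (u.evalEval x y) ^ 2 ≤ U ^ 2 := by rw [← sq_abs]; gcongr; exact hU x hx y hy'
      have hv2 : (v.evalEval x y) ^ 2 ≤ V ^ 2 := by rw [← sq_abs]; gcongr; exact hV x hx y hy'
      have hf2 : (f.evalEval x y) ^ 2 ≤ |F| * f.evalEval x y := by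
        rw [sq]; gcongr
        exact (le_abs_self _).trans ((hF x hx y hy').trans (le_abs_self _))
      calc (D.eval x) ^ 2 ≤ 2 * ((u.evalEval x y) ^ 2 * (f.evalEval x y) ^ 2) +
            2 * ((v.evalEval x y) ^ 2 * (f.derivative.evalEval x y) ^ 2) := by
            rw [h1]
            nlinarith [sq_nonneg (u.evalEval x y * f.evalEval x y - v.evalEval x y *
              f.derivative.evalEval x y)]
        _ ≤ 2 * (U ^ 2 * (|F| * f.evalEval x y)) + 2 * (V ^ 2 * (M * f.evalEval x y)) := by
            gcongr
            exact hM x hx y hy'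
        _ = K * f.evalEval x y := by rw [hK]; ring
    have h3 : (slack d).eval y ≤ |S| := by
      have := hS x hx y hy'
      rw [evalEval_slack] at this
      exact (le_abs_self _).trans (this.trans (le_abs_self _))
    calc c * (D.eval x) ^ 2 * (slack d).eval y
        ≤ 1 / (K * |S| + 1) * (K * f.evalEval x y) * |S| := by
          gcongr
          exact min_le_left _ _
      _ = (K * |S|) / (K * |S| + 1) * f.evalEval x y := by ring
      _ ≤ 1 * f.evalEval x y := by
          gcongr
          rw [div_le_one (by positivity)]
          linarith
      _ = _ := one_mul _

end LowerBound

section Reduction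

/-- A bivariate polynomial without square factors of positive degree in `Y` is coprime to its
derivative, up to a factor depending on `X` only. -/
lemma exists_bezout {f : ℝ[X][Y]} (hf : f ≠ 0) (hsq : ∀ p : ℝ[X][Y], p ^ 2 ∣ f → p.natDegree = 0) :
    ∃ (u v : ℝ[X][Y]) (D : ℝ[X]), D ≠ 0 ∧ u * f + v * f.derivative = C D := by
  classical
  obtain ⟨_⟩ : Nonempty (NormalizedGCDMonoid ℝ[X]) := inferInstance
  set φ := algebraMap ℝ[X] (FractionRing ℝ[X]) with hφ
  have hφi : Function.Injective φ := IsFractionRing.injective _ _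
  have hfm : f.map φ ≠ 0 := (Polynomial.map_ne_zero_iff hφi).2 hf
  have hnorm : ∀ q : (FractionRing ℝ[X])[X], ∃ (p : ℝ[X][Y]) (b : ℝ[X]), b ≠ 0 ∧
      p.map φ = C (φ b) * q := by
    intro q
    obtain ⟨b, hb, h⟩ := IsLocalization.integerNormalization_spec (nonZeroDivisors ℝ[X]) q
    refine ⟨_, b, nonZeroDivisors.ne_zero hb, h.trans ?_⟩
    rw [← algebraMap_smul (FractionRing ℝ[X]) b q, smul_eq_C_mul]
  have hunit : ∀ b : ℝ[X], b ≠ 0 → IsUnit (C (φ b)) := fun b hb =>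
    isUnit_C.2 (isUnit_iff_ne_zero.2 ((map_ne_zero_iff φ hφi).2 hb))
  have hsf : Squarefree (f.map φ) := by
    intro q hq
    obtain ⟨p, b, hb, hp⟩ := hnorm q
    have hq0 : q ≠ 0 := by
      rintro rfl
      rw [mul_zero, zero_dvd_iff] at hq
      exact hfm hq
    have hpq : p.primPart.map φ ∣ q := by
      rw [← (hunit b hb).dvd_mul_left, ← hp]
      exact Polynomial.map_dvd φ p.primPart_dvd
    have hdvd : p.primPart ^ 2 ∣ f := by
      have hprim : (p.primPart ^ 2).IsPrimitive := by
        rw [sq]; exact p.isPrimitive_primPart.mul p.isPrimitive_primPart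
      refine hprim.dvd_of_fraction_map_dvd_fraction_map (K := FractionRing ℝ[X]) ?_
      rw [Polynomial.map_pow, sq]
      exact (mul_dvd_mul hpq hpq).trans hq
    have hdeg : q.natDegree = 0 := by
      rw [← hsq _ hdvd, natDegree_primPart, ← natDegree_map_eq_of_injective hφi, hp,
        natDegree_C_mul ((map_ne_zero_iff φ hφi).2 hb)]
    rw [eq_C_of_natDegree_eq_zero hdeg] at hq0 ⊢
    exact isUnit_C.2 (isUnit_iff_ne_zero.2 (C_ne_zero.1 hq0))
  obtain ⟨a, b, hab⟩ := PerfectField.separable_iff_squarefree.2 hsf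
  obtain ⟨u, c, hc, hu⟩ := hnorm a
  obtain ⟨v, e, he, hv⟩ := hnorm b
  refine ⟨C e * u, C c * v, c * e, mul_ne_zero hc he, map_injective φ hφi ?_⟩
  rw [derivative_map] at hab
  simp only [Polynomial.map_add, Polynomial.map_mul, map_C, hu, hv, map_mul]
  linear_combination (C (φ c) * C (φ e)) * hab

lemma nonneg_of_C_mul {p : ℝ[X]} {g : ℝ[X][Y]} (hp : ∀ x ∈ Set.Ioo (0 : ℝ) 1, 0 < p.eval x)
    (h : ∀ x ∈ Set.Icc (0 : ℝ) 1, ∀ y, 0 ≤ (C p * g).evalEval x y) :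
    ∀ x ∈ Set.Icc (0 : ℝ) 1, ∀ y, 0 ≤ g.evalEval x y := by
  intro x hx y
  rw [← closure_Ioo_zero_one] at hx
  refine nonneg_of_finite_exception isOpen_Ioo Set.finite_empty (g := fun x => g.evalEval x y)
    ((continuous_evalEval g).comp (by fun_prop : Continuous fun x : ℝ => (x, y)))
    (fun t ht _ => ?_) x hx
  have := h t (Set.Ioo_subset_Icc_self ht) y
  rw [evalEval_mul, evalEval_C] at this
  exact nonneg_of_mul_nonneg_right this (hp t ht)

lemma nonneg_of_sq_mul {p q : ℝ[X][Y]} (hp : p ≠ 0)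
    (h : ∀ x ∈ Set.Icc (0 : ℝ) 1, ∀ y, 0 ≤ (p ^ 2 * q).evalEval x y) :
    ∀ x ∈ Set.Icc (0 : ℝ) 1, ∀ y, 0 ≤ q.evalEval x y := by
  intro x hx y
  rw [← closure_Ioo_zero_one] at hx
  refine nonneg_of_finite_exception isOpen_Ioo (p.leadingCoeff.roots.toFinset.finite_toSet)
    (g := fun x => q.evalEval x y)
    ((continuous_evalEval q).comp (by fun_prop : Continuous fun x : ℝ => (x, y)))
    (fun t ht htp => ?_) x hx
  have hpt : p.map (evalRingHom t) ≠ 0 := by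
    intro h0
    refine htp ?_
    have := congrArg (fun r => r.coeff p.natDegree) h0
    simpa [hp] using this
  refine nonneg_of_finite_exception isOpen_univ
    ((p.map (evalRingHom t)).roots.toFinset.finite_toSet) (g := fun y => q.evalEval t y)
    ((continuous_evalEval q).comp (by fun_prop : Continuous fun y : ℝ => (t, y)))
    (fun s _ hs => ?_) y (by simp)
  have h1 := h t (Set.Ioo_subset_Icc_self ht) s
  rw [evalEval_mul, evalEval_pow] at h1
  have h2 : p.evalEval t s ≠ 0 := by
    intro h0
    refine hs ?_
    simp [hpt, eval_map_evalRingHom, h0]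
  exact nonneg_of_mul_nonneg_right h1 (by positivity)

lemma natDegree_eq_two_mul {f : ℝ[X][Y]} (hf0 : f ≠ 0)
    (hf : ∀ x ∈ Set.Icc (0 : ℝ) 1, ∀ y, 0 ≤ f.evalEval x y) :
    f.natDegree = 2 * (f.natDegree / 2) := by
  obtain ⟨x, hx, hxr⟩ := (Set.Icc_infinite zero_lt_one).exists_notMem_finset
    f.leadingCoeff.roots.toFinset
  have hlc : evalRingHom x f.leadingCoeff ≠ 0 := by
    simpa [hf0] using hxr
  have h := natDegree_le_of_mem_stripCone (map_C_mem_stripCone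
    (mem_boundedSumSq_of_nonneg (f.map (evalRingHom x)) fun y => by
      rw [eval_map_evalRingHom]; exact hf x hx y))
  rw [natDegree_map_eq_of_injective C_injective, natDegree_map_of_leadingCoeff_ne_zero _ hlc] at h
  omega

lemma C_X_sub_C_dvd_iff {f : ℝ[X][Y]} {r : ℝ} :
    C (X - C r) ∣ f ↔ f.map (evalRingHom r) = 0 := by
  rw [C_dvd_iff_dvd_coeff, Polynomial.ext_iff]
  simp [dvd_iff_isRoot]

lemma reflect_mem_stripCone {f : ℝ[X][Y]} {d : ℕ} (hf : f ∈ stripCone d) :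
    reflect (2 * d) f ∈ stripCone d :=
  map_mem_stripCone (AddMonoidHom.mk' (reflect (2 * d)) fun p q => reflect_add p q _)
    (fun p g hp hg => by
      rw [AddMonoidHom.mk'_apply, reflect_C_mul, sq, two_mul, reflect_mul g g hg hg, ← sq]
      exact C_mul_sq_mem_stripCone hp (natDegree_reflect_le.trans (by simp [hg]))) hf

lemma taylor_mem_stripCone (s : ℝ[X]) {f : ℝ[X][Y]} {d : ℕ} (hf : f ∈ stripCone d) :
    taylor s f ∈ stripCone d :=
  map_mem_stripCone (taylor s).toAddMonoidHom (fun p g hp hg => by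
    rw [LinearMap.toAddMonoidHom_coe, taylor_mul, taylor_C, taylor_pow]
    exact C_mul_sq_mem_stripCone hp (by rwa [natDegree_taylor])) hf

/-- The polynomial `G(X,Z) = Z ^ (2 * d) * F(X, 1 / Z)` inherits nonnegativity. -/
lemma reflect_nonneg {f : ℝ[X][Y]} {d : ℕ} (hd : f.natDegree ≤ 2 * d)
    (hf : ∀ x ∈ Set.Icc (0 : ℝ) 1, ∀ y, 0 ≤ f.evalEval x y) :
    ∀ x ∈ Set.Icc (0 : ℝ) 1, ∀ z, 0 ≤ (reflect (2 * d) f).evalEval x z := by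
  intro x hx z
  refine nonneg_of_finite_exception isOpen_univ (Set.finite_singleton (0 : ℝ))
    (g := fun z => (reflect (2 * d) f).evalEval x z)
    ((continuous_evalEval _).comp (by fun_prop : Continuous fun z : ℝ => (x, z)))
    (fun t _ ht => ?_) z (by simp)
  have ht0 : t ≠ 0 := ht
  let : Invertible t⁻¹ := invertibleOfNonzero (inv_ne_zero ht0)
  have h := eval₂_reflect_mul_pow (evalRingHom x) t⁻¹ (2 * d) f hd
  rw [eval₂_evalRingHom, invOf_eq_inv, inv_inv] at h
  have h1 := hf x hx t⁻¹
  rw [← h] at h1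
  exact nonneg_of_mul_nonneg_left h1 (by rw [pow_mul]; positivity)

/-- Squarefreeness in `Y` passes to the reversed polynomial. -/
lemma natDegree_eq_zero_of_sq_dvd_reflect {f : ℝ[X][Y]} {n : ℕ} (hn : f.natDegree = n)
    (hf : f ≠ 0) (hsq : ∀ p : ℝ[X][Y], p ^ 2 ∣ f → p.natDegree = 0) {p : ℝ[X][Y]}
    (hp : p ^ 2 ∣ reflect n f) : p.natDegree = 0 := by
  obtain ⟨q, hq⟩ := hp
  have hr0 : reflect n f ≠ 0 := fun h => hf (reflect_eq_zero_iff.1 h)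
  have hp0 : p ≠ 0 := by
    rintro rfl
    exact hr0 (by rw [hq]; simp)
  have hq0 : q ≠ 0 := by
    rintro rfl
    exact hr0 (by rw [hq]; simp)
  have hdeg : 2 * p.natDegree + q.natDegree ≤ n := by
    rw [← natDegree_pow, ← natDegree_mul (pow_ne_zero 2 hp0) hq0, ← hq]
    exact natDegree_reflect_le.trans (by simp [hn])
  have hc : (reflect n f).coeff 0 ≠ 0 := by
    rw [coeff_reflect, revAt_zero, ← hn]
    exact leadingCoeff_ne_zero.2 hf
  have hpc : p.coeff 0 ≠ 0 := by
    intro h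
    apply hc
    rw [hq, mul_coeff_zero, sq, mul_coeff_zero, h, zero_mul, zero_mul]
  have hdvd : (reflect p.natDegree p) ^ 2 ∣ f := by
    refine ⟨reflect (n - (p.natDegree + p.natDegree)) q, ?_⟩
    rw [sq, ← reflect_mul p p le_rfl le_rfl, ← reflect_mul (p * p) q natDegree_mul_le (by omega),
      ← sq, ← hq, Nat.add_sub_cancel' (by omega), reflect_reflect]
  have := hsq _ hdvd
  by_contra h0
  have h1 : (reflect p.natDegree p).coeff p.natDegree = 0 :=
    coeff_eq_zero_of_natDegree_lt (by omega)
  rw [coeff_reflect, revAt_le le_rfl, Nat.sub_self] at h1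
  exact hpc h1

lemma exists_eval_pos {f : ℝ[X][Y]} (hf0 : f ≠ 0)
    (hf : ∀ x ∈ Set.Icc (0 : ℝ) 1, ∀ y, 0 ≤ f.evalEval x y)
    (hdvd : ∀ r ∈ Set.Icc (0 : ℝ) 1, ¬ C (X - C r) ∣ f)
    (hsq : ∀ p : ℝ[X][Y], p ^ 2 ∣ f → p.natDegree = 0) :
    ∃ y₀, ∀ x ∈ Set.Icc (0 : ℝ) 1, 0 < f.evalEval x y₀ := by
  classical
  obtain ⟨u, v, D, hD, huv⟩ := exists_bezout hf0 hsq
  have hDzero : ∀ x ∈ Set.Icc (0 : ℝ) 1, ∀ y, f.evalEval x y = 0 → D.eval x = 0 := by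
    intro x hx y h0
    have hmin : IsLocalMin (fun z => (f.map (evalRingHom x)).eval z) y :=
      Filter.Eventually.of_forall fun z => by
        simp only [eval_map_evalRingHom, h0]
        exact hf x hx z
    have hder := hmin.deriv_eq_zero
    rw [Polynomial.deriv, derivative_map, eval_map_evalRingHom] at hder
    have := congrArg (evalEval x y) huv
    rwa [evalEval_add, evalEval_mul, evalEval_mul, h0, hder, mul_zero, mul_zero, add_zero,
      evalEval_C, eq_comm] at this
  obtain ⟨y₀, hy₀⟩ := Infinite.exists_notMem_finset
    (D.roots.toFinset.biUnion fun x => (f.map (evalRingHom x)).roots.toFinset)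
  refine ⟨y₀, fun x hx => lt_of_le_of_ne (hf x hx y₀) fun h => hy₀ ?_⟩
  refine Finset.mem_biUnion.2 ⟨x, ?_, ?_⟩
  · simp [hD, hDzero x hx y₀ h.symm]
  · rw [Multiset.mem_toFinset, mem_roots', IsRoot.def, eval_map_evalRingHom]
    exact ⟨fun h0 => hdvd x hx (C_X_sub_C_dvd_iff.2 h0), h.symm⟩

lemma mem_stripCone_of_squarefree {f : ℝ[X][Y]} {d : ℕ} (hf0 : f ≠ 0) (hd : f.natDegree = 2 * d)
    (hf : ∀ x ∈ Set.Icc (0 : ℝ) 1, ∀ y, 0 ≤ f.evalEval x y)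
    (hdvd : ∀ r ∈ Set.Icc (0 : ℝ) 1, ¬ C (X - C r) ∣ f)
    (hsq : ∀ p : ℝ[X][Y], p ^ 2 ∣ f → p.natDegree = 0) : f ∈ stripCone d := by
  obtain ⟨y₀, hy₀⟩ := exists_eval_pos hf0 hf hdvd hsq
  set F := taylor (C y₀) f with hF
  have hF0 : F ≠ 0 := fun h => hf0 ((taylor_eq_zero _ _).1 h)
  have hFd : F.natDegree = 2 * d := by rw [hF, natDegree_taylor, hd]
  have hFnn : ∀ x ∈ Set.Icc (0 : ℝ) 1, ∀ y, 0 ≤ F.evalEval x y := by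
    intro x hx y
    rw [hF, evalEval, taylor_eval, ← C_add]
    exact hf x hx _
  have hFsq : ∀ p : ℝ[X][Y], p ^ 2 ∣ F → p.natDegree = 0 := by
    rintro p ⟨q, hq⟩
    rw [← natDegree_taylor p (-C y₀)]
    refine hsq _ ⟨taylor (-C y₀) q, ?_⟩
    rw [← taylor_pow, ← taylor_mul, ← hq, hF, taylor_taylor, neg_add_cancel, taylor_zero]
  set G := reflect (2 * d) F with hG
  have hG0 : G ≠ 0 := fun h => hF0 (reflect_eq_zero_iff.1 h)
  have hGd : G.natDegree ≤ 2 * d := natDegree_reflect_le.trans (by simp [hFd])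
  have hGlc : ∀ x ∈ Set.Icc (0 : ℝ) 1, 0 < (G.coeff (2 * d)).eval x := by
    intro x hx
    rw [hG, coeff_reflect, revAt_le le_rfl, Nat.sub_self, hF, taylor_coeff_zero]
    exact hy₀ x hx
  have hGnn := reflect_nonneg hFd.le hFnn
  obtain ⟨u, v, D, hD, huv⟩ := exists_bezout hG0 fun p hp =>
    natDegree_eq_zero_of_sq_dvd_reflect hFd hF0 hFsq hp
  obtain ⟨E, hE, hEle⟩ := exists_slack_le hGd hGlc hGnn hD huv
  have hGmem := mem_stripCone_of_slack_le hGd hGlc hE hEle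
  have := taylor_mem_stripCone (-C y₀) (reflect_mem_stripCone hGmem)
  rwa [hG, reflect_reflect, hF, taylor_taylor, neg_add_cancel, taylor_zero] at this

/-- A polynomial that is nonnegative on the strip belongs to the cone. -/
theorem mem_stripCone_of_nonneg (f : ℝ[X][Y]) (d : ℕ) (hd : f.natDegree ≤ 2 * d)
    (hf : ∀ x ∈ Set.Icc (0 : ℝ) 1, ∀ y, 0 ≤ f.evalEval x y) : f ∈ stripCone d := by
  induction hn : f.natDegree + f.leadingCoeff.natDegree using Nat.strong_induction_on
    generalizing f d with
  | _ n ih =>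
  subst hn
  by_cases hf0 : f = 0
  · rw [hf0]; exact zero_mem _
  have hmeas : ∀ (p : ℝ[X]) (g : ℝ[X][Y]), f = C p * g → g.natDegree = f.natDegree ∧
      f.leadingCoeff.natDegree = p.natDegree + g.leadingCoeff.natDegree := by
    rintro p g rfl
    have hp : p ≠ 0 := fun h => hf0 (by rw [h, C_0, zero_mul])
    have hg : g ≠ 0 := right_ne_zero_of_mul hf0
    rw [natDegree_C_mul hp, leadingCoeff_mul, leadingCoeff_C,
      natDegree_mul hp (leadingCoeff_ne_zero.2 hg)]
    exact ⟨rfl, rfl⟩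
  have hlin : ∀ (p : ℝ[X]) (g : ℝ[X][Y]), f = C p * g → 0 < p.natDegree →
      (∀ x ∈ Set.Icc (0 : ℝ) 1, 0 ≤ p.eval x) →
      (∀ x ∈ Set.Icc (0 : ℝ) 1, ∀ y, 0 ≤ g.evalEval x y) → f ∈ stripCone d := by
    intro p g hfg hp hpn hg
    obtain ⟨h1, h2⟩ := hmeas p g hfg
    rw [hfg]
    exact C_mul_mem_stripCone hpn (ih _ (by omega) g d (by omega) hg rfl)
  by_cases hdvd : ∃ r ∈ Set.Icc (0 : ℝ) 1, C (X - C r) ∣ f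
  · obtain ⟨r, hr, g, hg⟩ := hdvd
    rcases eq_or_lt_of_le hr.1 with rfl | hr0
    · rw [C_0, sub_zero] at hg
      refine hlin X g hg (by simp) (fun x hx => by simpa using hx.1) (nonneg_of_C_mul
        (p := X) (fun x hx => by simpa using hx.1) (by rwa [← hg]))
    rcases eq_or_lt_of_le hr.2 with rfl | hr1
    · have hg' : f = C (1 - X) * (-g) := by
        rw [hg, C_sub, C_sub]; simp only [C_1]; ring
      refine hlin (1 - X) (-g) hg' ?_ (fun x hx => by simpa using hx.2) (nonneg_of_C_mul
        (p := 1 - X) (fun x hx => by simpa using hx.2) (by rwa [← hg']))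
      rw [← natDegree_neg, neg_sub, ← C_1, natDegree_X_sub_C]
      exact one_pos
    have hgr : C (X - C r) ∣ g := by
      rw [C_X_sub_C_dvd_iff]
      refine Polynomial.funext fun y => ?_
      rw [eval_map_evalRingHom, eval_zero]
      refine eq_zero_of_sub_mul_nonneg isOpen_Ioo (⟨hr0, hr1⟩ : r ∈ Set.Ioo (0 : ℝ) 1)
        (g := fun x => g.evalEval x y)
        ((continuous_evalEval g).comp (by fun_prop : Continuous fun x : ℝ => (x, y)))
        fun x hx => ?_
      have := hf x (Set.Ioo_subset_Icc_self hx) y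
      rwa [hg, evalEval_mul, evalEval_C, eval_sub, eval_X, eval_C] at this
    obtain ⟨q, rfl⟩ := hgr
    have hq : f = C (X - C r) ^ 2 * q := by rw [hg]; ring
    refine hlin ((X - C r) ^ 2) q (by rw [hq, C_pow]) (by simp)
      (fun x _ => by rw [eval_pow]; exact sq_nonneg _)
      (nonneg_of_sq_mul (C_ne_zero.2 (X_sub_C_ne_zero r)) (by rwa [← hq]))
  by_cases hsq : ∃ p : ℝ[X][Y], p ^ 2 ∣ f ∧ p.natDegree ≠ 0
  · obtain ⟨p, ⟨q, rfl⟩, hp⟩ := hsq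
    have hp0 : p ≠ 0 := by rintro rfl; simp at hp
    have hq0 : q ≠ 0 := right_ne_zero_of_mul hf0
    have h1 : (p ^ 2 * q).natDegree = 2 * p.natDegree + q.natDegree := by
      rw [natDegree_mul (pow_ne_zero 2 hp0) hq0, natDegree_pow]
    have h2 : q.leadingCoeff.natDegree ≤ (p ^ 2 * q).leadingCoeff.natDegree := by
      rw [leadingCoeff_mul, leadingCoeff_pow, natDegree_mul
        (pow_ne_zero 2 (leadingCoeff_ne_zero.2 hp0)) (leadingCoeff_ne_zero.2 hq0)]
      omega
    have := sq_mul_mem_stripCone le_rfl (ih _ (by omega) q (d - p.natDegree) (by omega)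
      (nonneg_of_sq_mul hp0 hf) rfl) (q := p)
    rwa [Nat.sub_add_cancel (by omega)] at this
  push Not at hdvd hsq
  exact stripCone_mono (by omega) (mem_stripCone_of_squarefree hf0 (natDegree_eq_two_mul hf0 hf) hf
    hdvd hsq)

end Reduction

section Conversion

open Polynomial.Bivariate

lemma isSumSq_map {R S F : Type*} [NonAssocSemiring R] [NonAssocSemiring S] [FunLike F R S]
    [RingHomClass F R S] (φ : F) {s : R} (hs : IsSumSq s) : IsSumSq (φ s) := by
  induction hs with
  | zero => rw [map_zero]; exact .zero
  | sq_add a _ ih => rw [map_add, map_mul]; exact .sq_add (φ a) ih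

lemma evalEval_equivMvPolynomial_symm (f : MvPolynomial (Fin 2) ℝ) (x y : ℝ) :
    ((equivMvPolynomial ℝ).symm f).evalEval x y = MvPolynomial.eval ![x, y] f := by
  induction f using MvPolynomial.induction_on with
  | C a => rw [equivMvPolynomial_symm_C]; simp
  | add p q hp hq => rw [map_add, evalEval_add, hp, hq, map_add]
  | mul_X p i hp =>
    rw [map_mul, evalEval_mul, hp, map_mul, MvPolynomial.eval_X]
    congr 1
    fin_cases i
    · simp [equivMvPolynomial_symm_X_0, evalEval_C]
    · simp [equivMvPolynomial_symm_X_1]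

lemma exists_isSumSq_of_mem_stripCone {d : ℕ} {P : ℝ[X][Y]} (hP : P ∈ stripCone d) :
    ∃ σ₀ σ₁ : MvPolynomial (Fin 2) ℝ, IsSumSq σ₀ ∧ IsSumSq σ₁ ∧
      equivMvPolynomial ℝ P =
        σ₀ + σ₁ * (MvPolynomial.X 0 * (1 - MvPolynomial.X 0)) := by
  induction hP using AddSubmonoid.closure_induction with
  | mem P h =>
    obtain ⟨p, g, hp, -, rfl⟩ := h
    obtain ⟨s₀, s₁, h₀, h₁, rfl⟩ := intervalCert_of_nonneg p hp
    set e := equivMvPolynomial ℝ with he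
    have hmap : ∀ s : ℝ[X], IsSumSq s → IsSumSq (e (C s)) :=
      fun s hs => isSumSq_map e (isSumSq_map C hs)
    refine ⟨e (C s₀) * e g ^ 2, e (C s₁) * e g ^ 2, (hmap _ h₀).mul (isSumSq_sq _),
      (hmap _ h₁).mul (isSumSq_sq _), ?_⟩
    rw [map_mul, map_pow, C_add, C_mul, C_mul, C_sub, C_1, map_add, map_mul, map_mul, map_sub,
      map_one, he, equivMvPolynomial_C_X]
    ring
  | zero => exact ⟨0, 0, .zero, .zero, by simp⟩
  | add P Q _ _ hP hQ =>
    obtain ⟨a, b, ha, hb, hab⟩ := hP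
    obtain ⟨c, e, hc, he, hce⟩ := hQ
    exact ⟨a + c, b + e, ha.add hc, hb.add he, by rw [map_add, hab, hce]; ring⟩

end Conversion

end StripPositivity

open MvPolynomial

theorem stmt_19 (f : MvPolynomial (Fin 2) ℝ)
    (hf : ∀ x y : ℝ, x ∈ Set.Icc (0:ℝ) 1 → 0 ≤ eval ![x, y] f) :
    ∃ σ₀ σ₁ : MvPolynomial (Fin 2) ℝ, IsSumSq σ₀ ∧ IsSumSq σ₁ ∧
      f = σ₀ + σ₁ * (X 0 * (1 - X 0)) := by
  have h := StripPositivity.mem_stripCone_of_nonneg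
    ((Polynomial.Bivariate.equivMvPolynomial ℝ).symm f) _ (Nat.le_mul_of_pos_left _ two_pos)
    (fun x hx y => by
      rw [StripPositivity.evalEval_equivMvPolynomial_symm]; exact hf x y hx)
  simpa using StripPositivity.exists_isSumSq_of_mem_stripCone h
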